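/- Let $A_\Gamma$ be a 3-free Artin group and let $a, b, c \in X$ be pairwise distinct generators with $m(a,b) > 3$ and $m(b,c) > 3$. Let $\delta, \varepsilon \in \{1,-1\}$ and let $w b^{\delta} a^{\varepsilon}$ be a geodesic word over $X$. Then every geodesic word over $X$ representing the same element of $A_\Gamma$ ends in a letter of the form $a^{\pm 1}$, $b^{\pm 1}$, or $z^{\pm 1}$ for some $z \in X$ with $m(a,z) = 2$ (i.e., a letter that commutes with $a$). -/

import Mathlib

/-- The alternating product `x y x y ⋯` of length `n` in the free group, starting with `x`. -/
def altProd {X : Type*} : ℕ → X → X → FreeGroup X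
  | 0, _, _ => 1
  | n + 1, x, y => FreeGroup.of x * altProd n y x

/-- The Artin relations associated to a labelling `m : X → X → ℕ∞` (label `⊤` = no relation):
for each pair `x ≠ y` with finite label `k`, the relator `(xyx⋯)(yxy⋯)⁻¹` (both of length `k`). -/
def artinRels {X : Type*} (m : X → X → ℕ∞) : Set (FreeGroup X) :=
  { r | ∃ (x y : X) (k : ℕ), x ≠ y ∧ m x y = (k : ℕ∞) ∧
      r = altProd k x y * (altProd k y x)⁻¹ }

/-- The Artin group of the labelled graph encoded by `m`. -/
abbrev ArtinGroup {X : Type*} (m : X → X → ℕ∞) : Type _ := PresentedGroup (artinRels m)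

/-- The standard generators of the Artin group. -/
def artinGen {X : Type*} (m : X → X → ℕ∞) (x : X) : ArtinGroup m := PresentedGroup.of x

/-- The Artin monoid: the submonoid of the Artin group generated by the standard generators. -/
def artinMonoid {X : Type*} (m : X → X → ℕ∞) : Submonoid (ArtinGroup m) :=
  Submonoid.closure (Set.range (artinGen m))

/-- The monoid word metric on a group `G` relative to a submonoid `M`: `monoidDist M g h` is the
least `n` such that `g⁻¹ * h` is a product of `n` elements each lying in `M` or `M⁻¹`. -/
noncomputable def monoidDist {G : Type*} [Group G] (M : Submonoid G) (g h : G) : ℕ :=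
  sInf { n : ℕ | ∃ l : List G, l.length = n ∧ (∀ a ∈ l, a ∈ M ∨ a⁻¹ ∈ M) ∧ g⁻¹ * h = l.prod }

/-- A word over `X`: a list of letters `x^ε`, where `ε = true` denotes the positive letter `x`
and `ε = false` the negative letter `x⁻¹`. -/
abbrev Word (X : Type*) := List (X × Bool)

/-- The element of `G` represented by a word over `X`, given `f : X → G`. -/
def evalWord {X G : Type*} [Group G] (f : X → G) (w : Word X) : G :=
  (w.map (fun p => if p.2 then f p.1 else (f p.1)⁻¹)).prod

/-- A word is positive if all its letters are positive. -/
def IsPosWord {X : Type*} (w : Word X) : Prop := ∀ p ∈ w, p.2 = true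

/-- A word is negative if all its letters are negative. -/
def IsNegWord {X : Type*} (w : Word X) : Prop := ∀ p ∈ w, p.2 = false

/-- A word is geodesic if no strictly shorter word represents the same element of `G`. -/
def IsGeodesic {X G : Type*} [Group G] (f : X → G) (w : Word X) : Prop :=
  ∀ v : Word X, evalWord f v = evalWord f w → w.length ≤ v.length

/-- `(u, x)` is a blocking pair if for every word `w` such that `w ++ u` is geodesic,
the word `w ++ u ++ [x]` is also geodesic. -/
def BlockingPair {X G : Type*} [Group G] (f : X → G) (u : Word X) (x : X × Bool) : Prop :=
  ∀ w : Word X, IsGeodesic f (w ++ u) → IsGeodesic f (w ++ u ++ [x])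

/-- An alternating blocking sequence `(α n)` (indexed from `n = 1`; the value `α 0` is ignored):
each `α n` is nonempty, positive for odd `n` and negative for even `n`, and every letter `x`
of `α n` is immediately preceded, within `α (n-1) ++ α n` (with `α 0` read as the empty word),
by a subword `u` such that `(u, x)` is a blocking pair. -/
def IsAltBlockingSeq {X G : Type*} [Group G] (f : X → G) (α : ℕ → Word X) : Prop :=
  (∀ n, 1 ≤ n → α n ≠ []) ∧
  (∀ n, 1 ≤ n → Odd n → IsPosWord (α n)) ∧
  (∀ n, 1 ≤ n → Even n → IsNegWord (α n)) ∧
  (∀ n, 1 ≤ n → ∀ p x s, α n = p ++ x :: s →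
    ∃ u : Word X, u <:+ ((if n = 1 then ([] : Word X) else α (n - 1)) ++ p) ∧
      BlockingPair f u x)

/-- `u` is the longest positive (`ε = true`) resp. negative (`ε = false`) proper suffix of `w`. -/
def IsLongestSignedProperSuffix {X : Type*} (ε : Bool) (w u : Word X) : Prop :=
  u <:+ w ∧ u ≠ w ∧ (∀ p ∈ u, p.2 = ε) ∧
    ∀ v : Word X, v <:+ w → v ≠ w → (∀ p ∈ v, p.2 = ε) → v.length ≤ u.length

/-- Preserved positive (`ε = true`) resp. negative (`ε = false`) suffixes: whenever `w` is a
geodesic word ending in a letter of sign `ε`, `u` is the longest proper suffix of `w` of sign `ε`,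
and `a` is a generator, the element represented by `a^ε · w` admits a geodesic representative
having `u` as a suffix. -/
def PreservedSignSuffixes {X G : Type*} [Group G] (ε : Bool) (f : X → G) : Prop :=
  ∀ (w : Word X) (y : X), IsGeodesic f w → w.getLast? = some (y, ε) →
    ∀ u : Word X, IsLongestSignedProperSuffix ε w u →
    ∀ a : X, ∃ w' : Word X, IsGeodesic f w' ∧
      evalWord f w' = evalWord f ((a, ε) :: w) ∧ u <:+ w'

/-- Preserved signed suffixes: both preserved positive and preserved negative suffixes. -/
def PreservedSignedSuffixes {X G : Type*} [Group G] (f : X → G) : Prop :=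
  PreservedSignSuffixes true f ∧ PreservedSignSuffixes false f

namespace ArtinGeodesic

section Length

variable {Y : Type*} {m : Y → Y → ℕ∞}

/-- The formal inverse of a letter. -/
def flip (s : Y × Bool) : Y × Bool := (s.1, !s.2)

@[simp] lemma flip_flip (s : Y × Bool) : flip (flip s) = s := by simp [flip]

@[simp] lemma flip_fst (s : Y × Bool) : (flip s).1 = s.1 := rfl

lemma flip_ne (s : Y × Bool) : flip s ≠ s := by
  rcases s with ⟨x, b⟩
  cases b <;> simp [flip]

lemma eq_or_eq_flip {s t : Y × Bool} (h : s.1 = t.1) : s = t ∨ s = flip t := by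
  rcases s with ⟨x, b⟩
  rcases t with ⟨y, c⟩
  simp only at h
  subst h
  cases b <;> cases c <;> simp [flip]

/-- The group element represented by a letter. -/
def gl (m : Y → Y → ℕ∞) (s : Y × Bool) : ArtinGroup m :=
  if s.2 then artinGen m s.1 else (artinGen m s.1)⁻¹

@[simp] lemma gl_flip (s : Y × Bool) : gl m (flip s) = (gl m s)⁻¹ := by
  rcases s with ⟨x, b⟩
  cases b <;> simp [gl, flip]

/-- The value of a word in the Artin group. -/
abbrev ev (m : Y → Y → ℕ∞) (w : Word Y) : ArtinGroup m := evalWord (artinGen m) w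

@[simp] lemma ev_nil : ev m [] = 1 := rfl

@[simp] lemma ev_append (u v : Word Y) : ev m (u ++ v) = ev m u * ev m v := by
  simp [ev, evalWord]

@[simp] lemma ev_cons (s : Y × Bool) (v : Word Y) : ev m (s :: v) = gl m s * ev m v := by
  simp [ev, evalWord, gl]

lemma ev_replicate (s : Y × Bool) (n : ℕ) : ev m (List.replicate n s) = gl m s ^ n := by
  induction n with
  | zero => simp
  | succ n ih => rw [List.replicate_succ, ev_cons, ih, pow_succ']

lemma ev_surjective (g : ArtinGroup m) : ∃ w : Word Y, ev m w = g := by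
  obtain ⟨f, rfl⟩ := PresentedGroup.mk_surjective _ g
  obtain ⟨w, rfl⟩ := Quot.exists_rep f
  refine ⟨w, ?_⟩
  induction w with
  | nil => rfl
  | cons s w ih =>
    rw [ev_cons, ih]
    have : (Quot.mk FreeGroup.Red.Step (s :: w) : FreeGroup Y)
        = FreeGroup.mk [s] * FreeGroup.mk w := by
      rw [FreeGroup.mul_mk]; rfl
    rw [this, map_mul]
    congr 1
    rcases s with ⟨x, b⟩
    cases b
    · have h2 : (FreeGroup.mk [(x, false)] : FreeGroup Y) = (FreeGroup.of x)⁻¹ := rfl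
      rw [h2, map_inv]
      rfl
    · rfl

/-- Word length in the Artin group. -/
noncomputable def len (g : ArtinGroup m) : ℕ := sInf { n | ∃ w : Word Y, ev m w = g ∧ w.length = n }

lemma exists_geodesic (g : ArtinGroup m) : ∃ w : Word Y, ev m w = g ∧ w.length = len g := by
  have hne : { n | ∃ w : Word Y, ev m w = g ∧ w.length = n }.Nonempty := by
    obtain ⟨w, hw⟩ := ev_surjective g
    exact ⟨_, w, hw, rfl⟩
  exact Nat.sInf_mem hne

lemma len_le (w : Word Y) : len (ev m w) ≤ w.length := Nat.sInf_le ⟨w, rfl, rfl⟩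

@[simp] lemma len_one : len (1 : ArtinGroup m) = 0 := by
  have := len_le (m := m) []
  simpa using this

lemma len_eq_zero {g : ArtinGroup m} : len g = 0 ↔ g = 1 := by
  constructor
  · intro h
    obtain ⟨w, hw, hl⟩ := exists_geodesic g
    rw [h, List.length_eq_zero_iff] at hl
    rw [← hw, hl, ev_nil]
  · rintro rfl
    exact len_one

lemma len_mul_le (g h : ArtinGroup m) : len (g * h) ≤ len g + len h := by
  obtain ⟨w, rfl, hl⟩ := exists_geodesic g
  obtain ⟨v, rfl, hl'⟩ := exists_geodesic h
  rw [← hl, ← hl', ← ev_append, ← List.length_append]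
  exact len_le _

lemma ev_singleton (s : Y × Bool) : ev m [s] = gl m s := by simp

lemma len_gl_le (s : Y × Bool) : len (gl m s) ≤ 1 := by
  rw [← ev_singleton]
  exact len_le _

/-- The exponent sum. -/
def expSum (m : Y → Y → ℕ∞) : ArtinGroup m →* Multiplicative ℤ :=
  PresentedGroup.toGroup (f := fun _ => Multiplicative.ofAdd 1) (by
    rintro r ⟨x, y, k, -, -, rfl⟩
    rw [map_mul, map_inv, mul_inv_eq_one]
    have : ∀ (k : ℕ) (x y x' y' : Y),
        FreeGroup.lift (fun _ : Y => Multiplicative.ofAdd (1 : ℤ)) (altProd k x y)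
          = FreeGroup.lift (fun _ : Y => Multiplicative.ofAdd (1 : ℤ)) (altProd k x' y') := by
      intro k
      induction k with
      | zero => intros; rfl
      | succ k ih =>
        intro x y x' y'
        simp only [altProd, map_mul, FreeGroup.lift_apply_of]
        rw [ih y x y' x']
    exact this _ _ _ _ _)

/-- The sign of a letter. -/
def sgn (s : Y × Bool) : ℤ := if s.2 then 1 else -1

lemma expSum_gl (s : Y × Bool) : (expSum m (gl m s)).toAdd = sgn s := by
  have : ∀ x : Y, expSum m (artinGen m x) = Multiplicative.ofAdd 1 :=
    fun x => PresentedGroup.toGroup.of _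
  rcases s with ⟨x, b⟩
  cases b <;> simp [gl, sgn, this]

lemma expSum_ev (w : Word Y) : (expSum m (ev m w)).toAdd = (w.map sgn).sum := by
  induction w with
  | nil => simp
  | cons s w ih => simp [ih, expSum_gl]

lemma expSum_parity (w : Word Y) : ((expSum m (ev m w)).toAdd - w.length) % 2 = 0 := by
  rw [expSum_ev]
  induction w with
  | nil => simp
  | cons s w ih =>
    have : sgn s = 1 ∨ sgn s = -1 := by unfold sgn; split_ifs <;> simp
    simp only [List.map_cons, List.sum_cons, List.length_cons]
    push_cast
    omega

lemma len_parity (g : ArtinGroup m) : ((expSum m g).toAdd - len g) % 2 = 0 := by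
  obtain ⟨w, rfl, hl⟩ := exists_geodesic g
  rw [← hl]
  exact expSum_parity w

lemma len_mul_gl (g : ArtinGroup m) (s : Y × Bool) :
    len (g * gl m s) = len g + 1 ∨ len (g * gl m s) + 1 = len g := by
  have h1 : len (g * gl m s) ≤ len g + 1 :=
    (len_mul_le _ _).trans (by have := len_gl_le (m := m) s; omega)
  have h2 : len g ≤ len (g * gl m s) + 1 := by
    have := len_mul_le (g * gl m s) (gl m (flip s))
    rw [gl_flip, mul_inv_cancel_right] at this
    have h3 := len_gl_le (m := m) (flip s)
    rw [gl_flip] at h3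
    omega
  have h3 := len_parity g
  have h4 := len_parity (g * gl m s)
  rw [map_mul, toAdd_mul, expSum_gl] at h4
  have : sgn s = 1 ∨ sgn s = -1 := by unfold sgn; split_ifs <;> simp
  omega

@[simp] lemma len_gl (s : Y × Bool) : len (gl m s) = 1 := by
  have := len_mul_gl (1 : ArtinGroup m) s
  simpa using this

/-- `s` is a possible last letter of a geodesic word for `g`. -/
def Desc (g : ArtinGroup m) (s : Y × Bool) : Prop := len (g * gl m (flip s)) + 1 = len g

lemma desc_mul_gl {g : ArtinGroup m} {s : Y × Bool} :
    Desc (g * gl m s) s ↔ len (g * gl m s) = len g + 1 := by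
  unfold Desc
  rw [gl_flip, mul_inv_cancel_right]
  exact eq_comm

lemma not_desc_iff {g : ArtinGroup m} {s : Y × Bool} :
    ¬ Desc g (flip s) ↔ len (g * gl m s) = len g + 1 := by
  unfold Desc
  rw [flip_flip]
  have := len_mul_gl g s
  omega

lemma exists_desc {g : ArtinGroup m} (h : g ≠ 1) :
    ∃ (s : Y × Bool) (u : ArtinGroup m), g = u * gl m s ∧ len g = len u + 1 := by
  obtain ⟨w, rfl, hl⟩ := exists_geodesic g
  rcases List.eq_nil_or_concat w with rfl | ⟨v, s, rfl⟩
  · exact absurd rfl h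
  · refine ⟨s, ev m v, by simp, ?_⟩
    rw [← hl]
    have h1 := len_mul_gl (ev m v) s
    have h2 := len_le (m := m) v
    simp only [List.concat_eq_append, ev_append, ev_singleton, List.length_append,
      List.length_singleton] at *
    omega

end Length

section DihedralModel

/-- Garside normal forms in the dihedral Artin group with label `n + 2`: the element
`Δ ^ (-κ)` times a positive word whose maximal alternating runs are recorded, last run first,
by their lengths minus one; `e` is the last letter of the positive word. -/
inductive St (n : ℕ) : Type
  | nil (κ : ℤ) : St n
  | cons (κ : ℤ) (e : Bool) (r : Fin (n + 1)) (rs : List (Fin (n + 1))) : St n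

variable {n : ℕ}

namespace St

/-- The normal form with given power of `Δ`, last letter and list of runs. -/
def mk (κ : ℤ) (e : Bool) : List (Fin (n + 1)) → St n
  | [] => nil κ
  | r :: rs => cons κ e r rs

/-- Right multiplication by a generator. -/
def act (i : Bool) : St n → St n
  | nil κ => cons κ i 0 []
  | cons κ e r rs =>
    if e = i then cons κ i 0 (r :: rs)
    else if h : r.val < n then cons κ i ⟨r.val + 1, by omega⟩ rs else mk (κ - 1) (!i) rs

/-- Right multiplication by the inverse of a generator. -/
def unact (i : Bool) : St n → St n
  | nil κ => cons (κ + 1) (!i) (Fin.last n) []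
  | cons κ e r rs =>
    if e = i then
      if r.val = 0 then mk κ i rs else cons κ (!i) ⟨r.val - 1, by omega⟩ rs
    else cons (κ + 1) (!i) (Fin.last n) (r :: rs)

lemma unact_act (i : Bool) (σ : St n) : unact i (act i σ) = σ := by
  cases σ with
  | nil κ => simp [act, unact, mk]
  | cons κ e r rs =>
    by_cases h : e = i
    · subst h; simp [act, unact, mk]
    · have he : e = !i := by cases e <;> cases i <;> simp_all
      subst he
      by_cases hr : r.val < n
      · simp [act, unact, hr]
      · have hrn : r = Fin.last n := by ext; simp; omega
        subst hrn
        cases rs <;> simp [act, unact, mk]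

lemma act_unact (i : Bool) (σ : St n) : act i (unact i σ) = σ := by
  cases σ with
  | nil κ => simp [act, unact, mk]
  | cons κ e r rs =>
    by_cases h : e = i
    · subst h
      by_cases hr : r.val = 0
      · have hr0 : r = 0 := by ext; simpa using hr
        subst hr0
        cases rs <;> simp [act, unact, mk]
      · have h1 : r.val - 1 < n := by omega
        have h2 : r.val - 1 + 1 = r.val := by omega
        simp [act, unact, hr, h1, h2]
    · have he : e = !i := by cases e <;> cases i <;> simp_all
      subst he
      simp [act, unact, mk]

/-- Right multiplication by a generator, as a permutation. -/
def perm (n : ℕ) (i : Bool) : Equiv.Perm (St n) := ⟨act i, unact i, unact_act i, act_unact i⟩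

/-- Right multiplication by an alternating product of generators starting with `i`. -/
def altAct : ℕ → Bool → St n → St n
  | 0, _, σ => σ
  | k + 1, i, σ => altAct k (!i) (act i σ)

/-- The letter at distance `j` from `e` in an alternating word. -/
def par (j : ℕ) (e : Bool) : Bool := xor (Nat.bodd j) e

lemma par_zero (e : Bool) : par 0 e = e := by simp [par]

lemma par_succ (j : ℕ) (e : Bool) : par (j + 1) e = par j (!e) := by
  simp [par, Nat.bodd_succ]

lemma par_add (a b : ℕ) (e : Bool) : par (a + b) e = par a (par b e) := by
  simp [par, Nat.bodd_add]

lemma par_not (j : ℕ) (e : Bool) : par j (!e) = !par j e := by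
  simp [par]

lemma par_par (j : ℕ) (e : Bool) : par j (par j e) = e := by
  simp [par]

lemma altAct_add (a b : ℕ) (i : Bool) (σ : St n) :
    altAct (a + b) i σ = altAct b (par a i) (altAct a i σ) := by
  induction a generalizing i σ with
  | zero => simp [altAct, par_zero]
  | succ a ih => rw [Nat.succ_add_eq_add_succ, Nat.add_succ, altAct, ih, altAct, par_succ]

lemma act_mk (κ : ℤ) (i : Bool) (L : List (Fin (n + 1))) : act i (mk κ i L) = cons κ i 0 L := by
  cases L <;> simp [act, mk]

lemma altAct_run (j : ℕ) (κ : ℤ) (e : Bool) (r : ℕ) (rs : List (Fin (n + 1))) (h : r + j < n + 1) :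
    altAct j (!e) (cons κ e ⟨r, by omega⟩ rs) = cons κ (par j e) ⟨r + j, h⟩ rs := by
  induction j generalizing e r with
  | zero => simp [altAct, par_zero]
  | succ j ih =>
    have h1 : r < n := by omega
    have h2 : act (!e) (cons κ e ⟨r, by omega⟩ rs) = cons κ (!e) ⟨r + 1, by omega⟩ rs := by
      simp [act, h1]
    rw [altAct, h2, ih (!e) (r + 1) (by omega), par_succ]
    congr 2
    omega

lemma altAct_pop (κ : ℤ) (e : Bool) (r d : ℕ) (rs : List (Fin (n + 1))) (h : r + d = n) :
    altAct (d + 1) (!e) (cons κ e ⟨r, by omega⟩ rs) = mk (κ - 1) (par d e) rs := by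
  rw [altAct_add, altAct_run d κ e r rs (by omega), par_not]
  simp [altAct, act, h]

lemma altAct_same (κ : ℤ) (i : Bool) (L : List (Fin (n + 1))) :
    altAct (n + 2) i (mk κ i L) = mk (κ - 1) (par n i) L := by
  rw [altAct, act_mk]
  exact altAct_pop κ i 0 n L (by omega)

lemma altAct_other (κ : ℤ) (e : Bool) (r : Fin (n + 1)) (rs : List (Fin (n + 1))) :
    altAct (n + 2) (!e) (cons κ e r rs) = cons (κ - 1) (par n e) r rs := by
  obtain ⟨r, hr⟩ := r
  obtain ⟨d, hd⟩ : ∃ d, r + d = n := ⟨n - r, by omega⟩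
  have h1 : n + 2 = (d + 1) + (r + 1) := by omega
  rw [h1, altAct_add, altAct_pop κ e r d rs hd, par_succ, Bool.not_not, altAct, act_mk]
  have := altAct_run r (κ - 1) (par d e) 0 rs (by omega)
  simp only [Nat.zero_add] at this
  refine this.trans ?_
  rw [← par_add, hd]

lemma altAct_comm (i : Bool) (σ : St n) : altAct (n + 2) i σ = altAct (n + 2) (!i) σ := by
  cases σ with
  | nil κ =>
    have h1 := altAct_same (n := n) κ i []
    have h2 := altAct_same (n := n) κ (!i) []
    exact h1.trans h2.symm
  | cons κ e r rs =>
    have h1 := altAct_same κ e (r :: rs)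
    have h2 := altAct_other κ e r rs
    by_cases h : i = e
    · subst h
      exact h1.trans h2.symm
    · have : i = !e := by cases i <;> cases e <;> simp_all
      subst this
      rw [Bool.not_not]
      exact h2.trans h1.symm

end St

variable {Y : Type*} {m : Y → Y → ℕ∞} (e : Y ≃ Bool)

/-- The right action of the dihedral Artin group on normal forms. -/
def rightAction (hm : ∀ x y : Y, x ≠ y → m x y = ((n + 2 : ℕ) : ℕ∞)) :
    ArtinGroup m →* (Equiv.Perm (St n))ᵐᵒᵖ :=
  PresentedGroup.toGroup (f := fun x => MulOpposite.op (St.perm n (e x))) (by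
    rintro r ⟨x, y, k, hxy, hk, rfl⟩
    have hk2 : k = n + 2 := by
      rw [hm x y hxy] at hk
      exact_mod_cast hk.symm
    subst hk2
    have key : ∀ (k : ℕ) (x y : Y), e y = !(e x) → ∀ σ : St n,
        (FreeGroup.lift (fun x => MulOpposite.op (St.perm n (e x))) (altProd k x y)).unop σ
          = St.altAct k (e x) σ := by
      intro k
      induction k with
      | zero => intros; rfl
      | succ k ih =>
        intro x y h σ
        simp only [altProd, map_mul, FreeGroup.lift_apply_of, MulOpposite.unop_mul,
          MulOpposite.unop_op, Equiv.Perm.coe_mul, Function.comp_apply]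
        rw [ih y x (by rw [h, Bool.not_not]), h]
        rfl
    have hxy' : e y = !(e x) := by
      have : e y ≠ e x := fun h => hxy (e.injective h).symm
      cases hx : e x <;> cases hy : e y <;> simp_all
    rw [map_mul, map_inv, mul_inv_eq_one]
    apply MulOpposite.unop_injective
    ext σ
    rw [key _ x y hxy', key _ y x (by rw [hxy', Bool.not_not]), hxy']
    exact St.altAct_comm _ _)

variable (hm : ∀ x y : Y, x ≠ y → m x y = ((n + 2 : ℕ) : ℕ∞))

/-- The normal form of an element. -/
def nf (g : ArtinGroup m) : St n := (rightAction e hm g).unop (St.nil 0)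

/-- Right multiplication of a normal form by a letter. -/
def St.actL (i ε : Bool) (σ : St n) : St n := if ε then σ.act i else σ.unact i

lemma nf_one : nf e hm 1 = St.nil 0 := by simp [nf]

lemma nf_mul_gl (g : ArtinGroup m) (s : Y × Bool) :
    nf e hm (g * gl m s) = (nf e hm g).actL (e s.1) s.2 := by
  rcases s with ⟨x, b⟩
  cases b
  · simp only [nf, gl, map_mul, St.actL, MulOpposite.unop_mul]
    rfl
  · simp only [nf, gl, map_mul, St.actL, MulOpposite.unop_mul]
    rfl

/-- Alternating products in the dihedral Artin group ending in a given letter. -/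
def altE (m : Y → Y → ℕ∞) : ℕ → Bool → ArtinGroup m
  | 0, _ => 1
  | k + 1, i => altE m k (!i) * artinGen m (e.symm i)

lemma altE_succ' (k : ℕ) (i : Bool) :
    altE e m (k + 1) i = artinGen m (e.symm (St.par k i)) * altE e m k i := by
  induction k generalizing i with
  | zero => simp [altE, St.par_zero]
  | succ k ih =>
    rw [altE, ih, St.par_succ, mul_assoc]
    rfl

lemma altE_eq_altProd (k : ℕ) (i : Bool) :
    altE e m k (St.par (k + 1) i)
      = PresentedGroup.mk (artinRels m) (altProd k (e.symm i) (e.symm (!i))) := by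
  induction k generalizing i with
  | zero => simp [altE, altProd]
  | succ k ih =>
    rw [altE_succ', altProd, map_mul]
    have := ih (!i)
    rw [Bool.not_not] at this
    rw [← this]
    congr 2
    · congr 1
      rw [← St.par_add, show k + (k + 1 + 1) = (k + 1) + (k + 1) by omega, St.par_add, St.par_par]
    · rw [St.par_succ (k + 1)]

include hm in
lemma altE_comm (i : Bool) : altE e m (n + 2) i = altE e m (n + 2) (!i) := by
  have key : ∀ i, altE e m (n + 2) (St.par (n + 3) i) = altE e m (n + 2) (St.par (n + 3) (!i)) := by
    intro i
    rw [altE_eq_altProd, altE_eq_altProd, ← mul_inv_eq_one, ← map_inv, ← map_mul, Bool.not_not]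
    apply PresentedGroup.one_of_mem
    refine ⟨_, _, n + 2, ?_, hm _ _ ?_, rfl⟩ <;> simp
  have := key (St.par (n + 3) i)
  rwa [← St.par_not, St.par_par, St.par_par] at this

/-- The Garside element. -/
def garside (m : Y → Y → ℕ∞) (n : ℕ) : ArtinGroup m := altE e m (n + 2) true

include hm in
lemma altE_eq_garside (i : Bool) : altE e m (n + 2) i = garside e m n := by
  cases i
  · exact altE_comm e hm false
  · rfl

include hm in
lemma gen_mul_garside (i : Bool) :
    artinGen m (e.symm i) * garside e m n = garside e m n * artinGen m (e.symm (St.par n i)) := by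
  have h1 := altE_succ' (m := m) e (n + 2) (St.par n i)
  rw [show St.par (n + 2) (St.par n i) = i by
    rw [show n + 2 = (n + 1) + 1 from rfl, St.par_succ, St.par_succ, Bool.not_not, St.par_par],
    altE_eq_garside e hm, altE, altE_eq_garside e hm] at h1
  exact h1.symm

/-- The positive word recorded by a list of runs with a given last letter. -/
def runWord (m : Y → Y → ℕ∞) : Bool → List (Fin (n + 1)) → ArtinGroup m
  | _, [] => 1
  | i, r :: rs => runWord m (St.par r.val i) rs * altE e m (r.val + 1) i

include hm in
lemma altE_mul_garside (k : ℕ) (i : Bool) :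
    altE e m k i * garside e m n = garside e m n * altE e m k (St.par n i) := by
  induction k generalizing i with
  | zero => simp [altE]
  | succ k ih =>
    rw [altE, mul_assoc, gen_mul_garside e hm, ← mul_assoc, ih, altE, ← mul_assoc, St.par_not]

include hm in
lemma runWord_mul_garside (i : Bool) (rs : List (Fin (n + 1))) :
    runWord e m i rs * garside e m n = garside e m n * runWord e m (St.par n i) rs := by
  induction rs generalizing i with
  | nil => simp [runWord]
  | cons r rs ih =>
    rw [runWord, mul_assoc, altE_mul_garside e hm, ← mul_assoc, ih, runWord, ← mul_assoc,
      ← St.par_add, ← St.par_add, add_comm]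

/-- The element represented by a normal form. -/
def St.val (m : Y → Y → ℕ∞) : St n → ArtinGroup m
  | St.nil κ => garside e m n ^ (-κ)
  | St.cons κ i r rs => garside e m n ^ (-κ) * runWord e m i (r :: rs)

lemma St.val_mk (κ : ℤ) (i : Bool) (rs : List (Fin (n + 1))) :
    (St.mk κ i rs).val e m = garside e m n ^ (-κ) * runWord e m i rs := by
  cases rs <;> simp [St.mk, St.val, runWord]

include hm in
lemma St.val_act (i : Bool) (σ : St n) :
    (σ.act i).val e m = σ.val e m * artinGen m (e.symm i) := by
  cases σ with
  | nil κ => simp [St.act, St.val, runWord, altE]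
  | cons κ j r rs =>
    by_cases h : j = i
    · subst h
      simp [St.act, St.val, runWord, altE, mul_assoc, St.par_zero]
    · have he : j = !i := by cases j <;> cases i <;> simp_all
      subst he
      by_cases hr : r.val < n
      · simp [St.act, St.val, hr, runWord, St.par_succ, altE, mul_assoc]
      · have hrn : r.val = n := by omega
        have h2 : altE e m (n + 1) (!i) * artinGen m (e.symm i) = garside e m n :=
          altE_eq_garside e hm i
        have h3 : (St.cons κ (!i) r rs).act i = St.mk (κ - 1) (!i) rs := by simp [St.act, hr]
        rw [h3, St.val_mk]
        simp only [St.val, runWord, hrn]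
        rw [mul_assoc, mul_assoc, h2, runWord_mul_garside e hm, St.par_par, ← mul_assoc]
        congr 1
        rw [← zpow_add_one]
        congr 1
        ring

lemma val_nf (g : ArtinGroup m) : (nf e hm g).val e m = g := by
  obtain ⟨w, rfl⟩ := ev_surjective g
  induction w using List.reverseRecOn with
  | nil => simp [nf_one, St.val]
  | append_singleton w s ih =>
    rw [ev_append, ev_singleton, nf_mul_gl]
    rcases s with ⟨x, b⟩
    cases b
    · have := St.val_act e hm (e x) ((nf e hm (ev m w)).unact (e x))
      rw [St.act_unact, ih, Equiv.symm_apply_apply] at this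
      simp only [St.actL, gl]
      exact eq_mul_inv_of_mul_eq this.symm
    · simp only [St.actL, gl, if_true]
      rw [St.val_act e hm, ih, Equiv.symm_apply_apply]

lemma nf_eq_nil_zero {g : ArtinGroup m} (h : nf e hm g = St.nil 0) : g = 1 := by
  rw [← val_nf e hm g, h]
  simp [St.val]

end DihedralModel

section DihedralLength

variable {n : ℕ}

/-- The contribution of a run to the length estimate with parameter `c`. -/
def runWt (c : ℤ) (r : Fin (n + 1)) : ℤ := (r.val + 1) - 2 * max (r.val + 1 - c) 0

/-- The length estimate with parameter `c`. -/
def St.wt (c : ℤ) : St n → ℤ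
  | St.nil κ => (n + 2 - 2 * c) * κ
  | St.cons κ _ r rs => (n + 2 - 2 * c) * κ + (runWt c r + (rs.map (runWt c)).sum)

/-- The estimate with parameter `c` grows when acting by a generator. -/
def St.Up (c : ℤ) (i : Bool) : St n → Prop
  | St.nil _ => 1 ≤ c
  | St.cons _ e r _ => if e = i then 1 ≤ c else r.val + 1 < c

/-- The estimate with parameter `c` grows when acting by an inverse generator. -/
def St.Dn (c : ℤ) (i : Bool) : St n → Prop
  | St.nil _ => c < n + 2
  | St.cons _ e r _ => if e = i then c < r.val + 1 else c < n + 2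

lemma St.wt_mk (c κ : ℤ) (i : Bool) (L : List (Fin (n + 1))) :
    (St.mk κ i L).wt c = (n + 2 - 2 * c) * κ + (L.map (runWt c)).sum := by
  cases L <;> simp [St.mk, St.wt]

lemma St.wt_act {c : ℤ} (h0 : 0 ≤ c) (h1 : c ≤ n + 2) (i : Bool) (σ : St n) :
    (σ.Up c i ∧ (σ.act i).wt c = σ.wt c + 1) ∨ (¬ σ.Up c i ∧ (σ.act i).wt c = σ.wt c - 1) := by
  cases σ with
  | nil κ =>
    simp only [St.act, St.wt, St.Up, runWt, List.map_nil, List.sum_nil, Fin.val_zero]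
    push_cast
    by_cases h : 1 ≤ c
    · left; refine ⟨h, ?_⟩; rw [max_eq_right (by omega)]; ring
    · right; refine ⟨h, ?_⟩; rw [max_eq_left (by omega)]; have : c = 0 := by omega
      subst this; ring
  | cons κ e r rs =>
    obtain ⟨r, hr⟩ := r
    by_cases he : e = i
    · subst he
      simp only [St.act, St.wt, St.Up, runWt, List.map_cons, List.sum_cons, if_true, Fin.val_zero]
      push_cast
      by_cases h : 1 ≤ c
      · left; refine ⟨h, ?_⟩; rw [max_eq_right (b := (0 : ℤ)) (a := 1 - c) (by omega)]; ring
      · right; refine ⟨h, ?_⟩; rw [max_eq_left (b := (0 : ℤ)) (a := 1 - c) (by omega)]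
        have : c = 0 := by omega
        subst this; ring
    · by_cases hrn : r < n
      · simp only [St.act, St.wt, St.Up, runWt, if_neg he, dif_pos hrn]
        push_cast
        by_cases h : (r : ℤ) + 1 < c
        · left; refine ⟨h, ?_⟩; rw [max_eq_right (by omega), max_eq_right (by omega)]; ring
        · right; refine ⟨h, ?_⟩; rw [max_eq_left (by omega), max_eq_left (by omega)]; ring
      · have hr' : r = n := by omega
        subst hr'
        rw [show (St.cons κ e ⟨r, hr⟩ rs).act i = St.mk (κ - 1) (!i) rs by simp [St.act, he],
          St.wt_mk]
        simp only [St.wt, St.Up, runWt, if_neg he]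
        by_cases h : (r : ℤ) + 1 < c
        · left; refine ⟨h, ?_⟩; rw [max_eq_right (by omega)]
          have : c = r + 2 := by omega
          subst this; ring
        · right; refine ⟨h, ?_⟩; rw [max_eq_left (by omega)]; ring

lemma St.wt_unact {c : ℤ} (h0 : 0 ≤ c) (h1 : c ≤ n + 2) (i : Bool) (σ : St n) :
    (σ.Dn c i ∧ (σ.unact i).wt c = σ.wt c + 1) ∨
      (¬ σ.Dn c i ∧ (σ.unact i).wt c = σ.wt c - 1) := by
  cases σ with
  | nil κ =>
    simp only [St.unact, St.wt, St.Dn, runWt, List.map_nil, List.sum_nil, Fin.val_last]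
    by_cases h : c < n + 2
    · left; refine ⟨h, ?_⟩; rw [max_eq_left (by omega)]; ring
    · right; refine ⟨h, ?_⟩; rw [max_eq_right (by omega)]
      have : c = n + 2 := by omega
      subst this; ring
  | cons κ e r rs =>
    obtain ⟨r, hr⟩ := r
    by_cases he : e = i
    · subst he
      by_cases hr0 : r = 0
      · subst hr0
        rw [show (St.cons κ e ⟨0, hr⟩ rs).unact e = St.mk κ e rs by simp [St.unact], St.wt_mk]
        simp only [St.wt, St.Dn, runWt, if_true]
        push_cast
        by_cases h : c < 0 + 1
        · left; refine ⟨h, ?_⟩; rw [max_eq_left (by omega)]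
          have : c = 0 := by omega
          subst this; ring
        · right; refine ⟨h, ?_⟩; rw [max_eq_right (by omega)]; ring
      · simp only [St.unact, St.wt, St.Dn, runWt, if_true, if_neg hr0]
        push_cast [Nat.one_le_iff_ne_zero.mpr hr0]
        by_cases h : c < r + 1
        · left; refine ⟨h, ?_⟩; rw [max_eq_left (by omega), max_eq_left (by omega)]; ring
        · right; refine ⟨h, ?_⟩; rw [max_eq_right (by omega), max_eq_right (by omega)]; ring
    · simp only [St.unact, St.wt, St.Dn, runWt, if_neg he, Fin.val_last, List.map_cons,
        List.sum_cons]
      by_cases h : c < n + 2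
      · left; refine ⟨h, ?_⟩; rw [max_eq_left (a := (n : ℤ) + 1 - c) (by omega)]; ring
      · right; refine ⟨h, ?_⟩; rw [max_eq_right (a := (n : ℤ) + 1 - c) (by omega)]
        have : c = n + 2 := by omega
        subst this; ring

lemma St.wt_actL_le {c : ℤ} (h0 : 0 ≤ c) (h1 : c ≤ n + 2) (i ε : Bool) (σ : St n) :
    (σ.actL i ε).wt c ≤ σ.wt c + 1 := by
  cases ε
  · have := St.wt_unact h0 h1 i σ
    simp only [St.actL]
    grind
  · have := St.wt_act h0 h1 i σ
    simp only [St.actL]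
    grind

/-- The number of runs of at least the length of `r`. -/
def cntGe (l : ℤ) (L : List (Fin (n + 1))) : ℤ := (L.map fun r => if l ≤ r.val + 1 then 1 else 0).sum

lemma wt_sum_le_of_le {c l : ℤ} (h : c ≤ l) (L : List (Fin (n + 1))) :
    (L.map (runWt c)).sum + 2 * (l - c) * cntGe l L ≤ (L.map (runWt l)).sum := by
  induction L with
  | nil => simp [cntGe]
  | cons r L ih =>
    simp only [cntGe, List.map_cons, List.sum_cons] at ih ⊢
    have : runWt c r + 2 * (l - c) * (if l ≤ r.val + 1 then 1 else 0) ≤ runWt l r := by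
      unfold runWt
      split_ifs
      · rw [max_eq_left (by omega), max_eq_left (by omega)]; linarith
      · rw [max_eq_right (b := (0 : ℤ)) (a := r.val + 1 - l) (by omega)]
        have := le_max_right ((r.val : ℤ) + 1 - c) 0
        linarith
    linarith

lemma wt_sum_le_of_ge {c l : ℤ} (h : l ≤ c) (L : List (Fin (n + 1))) :
    (L.map (runWt c)).sum ≤ (L.map (runWt l)).sum + 2 * (c - l) * cntGe l L := by
  induction L with
  | nil => simp [cntGe]
  | cons r L ih =>
    simp only [cntGe, List.map_cons, List.sum_cons] at ih ⊢
    have : runWt c r ≤ runWt l r + 2 * (c - l) * (if l ≤ r.val + 1 then 1 else 0) := by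
      unfold runWt
      split_ifs
      · have h1 := le_max_left ((r.val : ℤ) + 1 - c) 0
        rw [max_eq_left (b := (0 : ℤ)) (a := r.val + 1 - l) (by omega)]
        linarith
      · rw [max_eq_right (by omega), max_eq_right (by omega)]; linarith
    linarith

lemma St.exists_decreasing {σ : St n} (h : σ ≠ St.nil 0) : ∃ i ε, ∀ N : ℤ,
    (∀ c : ℤ, 0 ≤ c → c ≤ n + 2 → σ.wt c ≤ N) →
      ∀ c : ℤ, 0 ≤ c → c ≤ n + 2 → (σ.actL i ε).wt c ≤ N - 1 := by
  cases σ with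
  | nil κ =>
    rcases lt_trichotomy κ 0 with hκ | hκ | hκ
    · refine ⟨true, false, fun N hN c h0 h1 => ?_⟩
      have hc := St.wt_unact h0 h1 true (St.nil κ)
      have h2 := hN (n + 2) (by positivity) le_rfl
      have h3 := hN c h0 h1
      simp only [St.actL, St.Dn, St.wt] at *
      rcases hc with ⟨h4, h5⟩ | ⟨h4, h5⟩
      · simp only [Bool.false_eq_true, if_false, h5]; nlinarith
      · simp only [Bool.false_eq_true, if_false, h5]; omega
    · exact absurd (by rw [hκ]) h
    · refine ⟨true, true, fun N hN c h0 h1 => ?_⟩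
      have hc := St.wt_act h0 h1 true (St.nil κ)
      have h2 := hN 0 le_rfl (by positivity)
      have h3 := hN c h0 h1
      simp only [St.actL, St.Up, St.wt] at *
      rcases hc with ⟨h4, h5⟩ | ⟨h4, h5⟩
      · simp only [if_true, h5]; nlinarith
      · simp only [if_true, h5]; omega
  | cons κ e r rs =>
    have hr := r.isLt
    set l : ℤ := r.val + 1 with hl
    by_cases hq : κ + 1 ≤ cntGe l (r :: rs)
    · refine ⟨e, false, fun N hN c h0 h1 => ?_⟩
      have hc := St.wt_unact h0 h1 e (St.cons κ e r rs)
      have h2 := hN l (by omega) (by omega)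
      have h3 := hN c h0 h1
      rw [show (St.cons κ e r rs).actL e false = (St.cons κ e r rs).unact e from rfl]
      rcases hc with ⟨h4, h5⟩ | ⟨h4, h5⟩
      · rw [h5]
        simp only [St.Dn, if_true] at h4
        have h6 := wt_sum_le_of_le (c := c) (l := l) (by omega) (r :: rs)
        simp only [St.wt, List.map_cons, List.sum_cons] at h2 h6 ⊢
        nlinarith
      · omega
    · refine ⟨!e, true, fun N hN c h0 h1 => ?_⟩
      have hc := St.wt_act h0 h1 (!e) (St.cons κ e r rs)
      have h2 := hN l (by omega) (by omega)
      have h3 := hN c h0 h1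
      rw [show (St.cons κ e r rs).actL (!e) true = (St.cons κ e r rs).act (!e) from rfl]
      rcases hc with ⟨h4, h5⟩ | ⟨h4, h5⟩
      · rw [h5]
        simp only [St.Up, Bool.eq_not_self, if_false] at h4
        have h6 := wt_sum_le_of_ge (c := c) (l := l) (by omega) rs
        have h7 : runWt c r = l ∧ runWt l r = l := by
          unfold runWt
          rw [max_eq_right (by omega), max_eq_right (by omega)]
          omega
        simp only [cntGe, List.map_cons, List.sum_cons, ← hl, le_refl, if_true] at hq
        have h8 : cntGe l rs ≤ κ - 1 := by unfold cntGe; omega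
        simp only [St.wt] at h2 ⊢
        nlinarith
      · omega

variable {Y : Type*} {m : Y → Y → ℕ∞} (e : Y ≃ Bool)
  (hm : ∀ x y : Y, x ≠ y → m x y = ((n + 2 : ℕ) : ℕ∞))

lemma wt_nf_le {c : ℤ} (h0 : 0 ≤ c) (h1 : c ≤ n + 2) (g : ArtinGroup m) :
    (nf e hm g).wt c ≤ len g := by
  obtain ⟨w, rfl, hl⟩ := exists_geodesic g
  rw [← hl]
  clear hl
  induction w using List.reverseRecOn with
  | nil => simp [nf_one, St.wt]
  | append_singleton w s ih =>
    rw [ev_append, ev_singleton, nf_mul_gl, List.length_append]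
    have := St.wt_actL_le h0 h1 (e s.1) s.2 (nf e hm (ev m w))
    push_cast [List.length_singleton]
    linarith

lemma len_le_of_wt_le (N : ℕ) (g : ArtinGroup m)
    (h : ∀ c : ℤ, 0 ≤ c → c ≤ n + 2 → (nf e hm g).wt c ≤ N) : len g ≤ N := by
  induction N generalizing g with
  | zero =>
    by_cases hg : nf e hm g = St.nil 0
    · rw [nf_eq_nil_zero e hm hg, len_one]
    · exfalso
      obtain ⟨i, ε, hs⟩ := St.exists_decreasing hg
      have h1 := hs _ h 0 le_rfl (by positivity)
      have h2 := hs _ h (n + 2) (by positivity) le_rfl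
      have h3 : ∀ σ : St n, σ.wt 0 + σ.wt (n + 2) = 0 := by
        have h4 : ∀ r : Fin (n + 1), runWt 0 r = - (r.val + 1) := fun r => by
          unfold runWt; rw [max_eq_left (by omega)]; ring
        have h5 : ∀ r : Fin (n + 1), runWt (n + 2) r = (r.val + 1) := fun r => by
          unfold runWt; rw [max_eq_right (by omega)]; ring
        have h6 : ∀ L : List (Fin (n + 1)),
            (L.map (runWt 0)).sum + (L.map (runWt (n + 2))).sum = 0 := by
          intro L
          induction L with
          | nil => simp
          | cons r L ih => simp only [List.map_cons, List.sum_cons, h4, h5] at *; linarith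
        intro σ
        cases σ with
        | nil κ => simp only [St.wt]; ring
        | cons κ j r rs =>
          have := h6 rs
          simp only [St.wt, h4, h5]
          linarith
      have := h3 ((nf e hm g).actL i ε)
      push_cast at h1 h2
      omega
  | succ N ih =>
    by_cases hg : nf e hm g = St.nil 0
    · rw [nf_eq_nil_zero e hm hg, len_one]
      omega
    · obtain ⟨i, ε, hs⟩ := St.exists_decreasing hg
      have h1 := ih (g * gl m (e.symm i, ε)) (by
        intro c h0 h1
        rw [nf_mul_gl, Equiv.apply_symm_apply]
        have := hs _ h c h0 h1
        push_cast at this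
        linarith)
      have := len_mul_gl g (e.symm i, ε)
      omega

lemma exists_wt_eq_len (g : ArtinGroup m) :
    ∃ c : ℤ, 0 ≤ c ∧ c ≤ n + 2 ∧ (nf e hm g).wt c = len g := by
  by_contra! hcon
  have h1 : ∀ c : ℤ, 0 ≤ c → c ≤ n + 2 → (nf e hm g).wt c ≤ len g - 1 := fun c h0 h1 => by
    have := wt_nf_le e hm h0 h1 g
    have := hcon c h0 h1
    omega
  by_cases hg : len g = 0
  · rw [len_eq_zero] at hg
    subst hg
    exact hcon 0 le_rfl (by positivity) (by simp [nf_one, St.wt])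
  · have := len_le_of_wt_le e hm (len g - 1) g (fun c h0 h2 => by
      have := h1 c h0 h2
      omega)
    omega

include e hm in
lemma dihedral_not_desc_flip (g : ArtinGroup m) (s : Y × Bool) :
    ¬ (Desc g s ∧ Desc g (flip s)) := by
  rintro ⟨h1, h2⟩
  obtain ⟨c, h0, hk, hc⟩ := exists_wt_eq_len e hm g
  have key : ∀ b : Bool, ((nf e hm g).actL (e s.1) b).wt c ≤ (nf e hm g).wt c - 1 := by
    intro b
    have h3 : Desc g (s.1, !b) := by
      rcases s with ⟨x, d⟩
      cases b <;> cases d <;> first | exact h1 | exact h2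
    have h4 := wt_nf_le e hm h0 hk (g * gl m (s.1, b))
    rw [nf_mul_gl] at h4
    unfold Desc at h3
    simp only [flip, Bool.not_not] at h3
    simp only at h4
    omega
  have ha := key true
  have hb := key false
  have h5 := St.wt_act h0 hk (e s.1) (nf e hm g)
  have h6 := St.wt_unact h0 hk (e s.1) (nf e hm g)
  simp only [St.actL, Bool.false_eq_true, if_true, if_false] at ha hb
  have h7 : ¬ (nf e hm g).Up c (e s.1) := by grind
  have h8 : ¬ (nf e hm g).Dn c (e s.1) := by grind
  cases hσ : nf e hm g with
  | nil κ =>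
    rw [hσ] at h7 h8
    simp only [St.Up, St.Dn] at h7 h8
    omega
  | cons κ j r rs =>
    have hr := r.isLt
    rw [hσ] at h7 h8
    simp only [St.Up, St.Dn] at h7 h8
    split_ifs at h7 h8 <;> omega

end DihedralLength

section FourSyllables

variable {Y : Type*} {m : Y → Y → ℕ∞}

lemma abs_expSum_le (g : ArtinGroup m) : |(expSum m g).toAdd| ≤ len g := by
  obtain ⟨w, rfl, hl⟩ := exists_geodesic g
  rw [← hl, expSum_ev]
  clear hl
  induction w with
  | nil => simp
  | cons s w ih =>
    have h : |sgn s| = 1 := by unfold sgn; split_ifs <;> simp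
    have := abs_add_le (sgn s) (w.map sgn).sum
    simp only [List.map_cons, List.sum_cons, List.length_cons]
    push_cast
    linarith

variable {n : ℕ} (e : Y ≃ Bool) (hm : ∀ x y : Y, x ≠ y → m x y = ((n + 2 : ℕ) : ℕ∞))

/-- The state of the normal form after reading a word ending in the letter `s` with at most `P`
positive and `N` negative syllables, all of whose letters increase the estimate with
parameter `c`. -/
def SyllableState (c P N : ℤ) (s : Y × Bool) (g : ArtinGroup m) (L : ℤ) : Prop :=
  ∃ κ r rs, nf e hm g = St.cons κ (if s.2 then e s.1 else !e s.1) r rs ∧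
    (if s.2 then (r.val : ℤ) + 1 ≤ P else (n : ℤ) + 2 ≤ r.val + 1 + N) ∧ (nf e hm g).wt c = L

/-- Contribution of a syllable to the count of syllables of sign `b`. -/
def sylCount (b : Bool) (s : Y × Bool) : ℤ := if s.2 = b then 1 else 0

variable {e hm}

lemma SyllableState.of_act {c P N : ℤ} (h0 : 0 ≤ c) (h1 : c ≤ n + 2) {x : Y} {g : ArtinGroup m}
    {L : ℤ} (hw : (nf e hm g).wt c = L) (hu : (nf e hm g).Up c (e x))
    {κ : ℤ} {r : Fin (n + 1)} {rs : List (Fin (n + 1))}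
    (h : (nf e hm g).act (e x) = St.cons κ (e x) r rs) (hr : (r.val : ℤ) + 1 ≤ P) :
    SyllableState e hm c P N (x, true) (g * gl m (x, true)) (L + 1) := by
  refine ⟨κ, r, rs, ?_, by simpa using hr, ?_⟩
  · rw [nf_mul_gl]; simpa [St.actL] using h
  · rw [nf_mul_gl]
    have := St.wt_act h0 h1 (e x) (nf e hm g)
    simp only [St.actL, if_true]
    grind

lemma SyllableState.of_unact {c P N : ℤ} (h0 : 0 ≤ c) (h1 : c ≤ n + 2) {x : Y}
    {g : ArtinGroup m} {L : ℤ} (hw : (nf e hm g).wt c = L) (hu : (nf e hm g).Dn c (e x))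
    {κ : ℤ} {r : Fin (n + 1)} {rs : List (Fin (n + 1))}
    (h : (nf e hm g).unact (e x) = St.cons κ (!e x) r rs) (hr : (n : ℤ) + 2 ≤ r.val + 1 + N) :
    SyllableState e hm c P N (x, false) (g * gl m (x, false)) (L + 1) := by
  refine ⟨κ, r, rs, ?_, by simpa using hr, ?_⟩
  · rw [nf_mul_gl]; simpa [St.actL] using h
  · rw [nf_mul_gl]
    have := St.wt_unact h0 h1 (e x) (nf e hm g)
    simp only [St.actL, Bool.false_eq_true, if_false]
    grind

lemma SyllableState.first {c : ℤ} (h0 : 1 ≤ c) (h1 : c < n + 2) (s : Y × Bool) :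
    SyllableState e hm c (sylCount true s) (sylCount false s) s (gl m s) 1 := by
  have hw : (nf e hm 1).wt c = 0 := by simp [nf_one, St.wt]
  rcases s with ⟨x, _ | _⟩
  · have := SyllableState.of_unact (P := 0) (N := 1) (x := x) (by omega) h1.le hw
      (by simpa [nf_one, St.Dn] using h1) (by rw [nf_one]; rfl) (by simp; omega)
    simpa [sylCount] using this
  · have := SyllableState.of_act (P := 1) (N := 0) (x := x) (by omega) h1.le hw
      (by simpa [nf_one, St.Up] using h0) (by rw [nf_one]; rfl) (by simp)
    simpa [sylCount] using this

lemma SyllableState.same {c P N L : ℤ} (h0 : 1 ≤ c) (h1 : c < n + 2) {s : Y × Bool}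
    {g : ArtinGroup m} (hP : sylCount true s ≤ P) (hN : sylCount false s ≤ N)
    (h : SyllableState e hm c P N s g L) :
    SyllableState e hm c P N s (g * gl m s) (L + 1) := by
  obtain ⟨κ, r, rs, h2, h3, h4⟩ := h
  rcases s with ⟨x, _ | _⟩
  · refine SyllableState.of_unact (κ := κ + 1) (r := Fin.last n) (rs := r :: rs)
      (by omega) h1.le h4 ?_ ?_ ?_
    · rw [h2]; simpa [St.Dn] using h1
    · rw [h2]; simp [St.unact]
    · simp [sylCount] at hN ⊢; omega
  · refine SyllableState.of_act (κ := κ) (r := 0) (rs := r :: rs) (by omega) h1.le h4 ?_ ?_ ?_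
    · rw [h2]; simpa [St.Up] using h0
    · rw [h2]; simp [St.act]
    · simp [sylCount] at hP ⊢; omega

lemma SyllableState.pow {c P N L : ℤ} (h0 : 1 ≤ c) (h1 : c < n + 2) {s : Y × Bool}
    {g : ArtinGroup m} (hP : sylCount true s ≤ P) (hN : sylCount false s ≤ N)
    (h : SyllableState e hm c P N s g L) (a : ℕ) :
    SyllableState e hm c P N s (g * gl m s ^ a) (L + a) := by
  induction a with
  | zero => simpa using h
  | succ a ih =>
    have := ih.same h0 h1 hP hN
    rw [pow_succ, ← mul_assoc]
    push_cast
    rwa [← add_assoc]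

lemma SyllableState.next {c P N L : ℤ} (h0 : 1 ≤ c) (h1 : c < n + 2) {s t : Y × Bool}
    (hst : s.1 ≠ t.1) {g : ArtinGroup m} (hP : 0 ≤ P) (hN : 0 ≤ N)
    (hP' : P + sylCount true t ≤ c) (hN' : N + sylCount false t ≤ n + 2 - c)
    (h : SyllableState e hm c P N s g L) :
    SyllableState e hm c (P + sylCount true t) (N + sylCount false t) t (g * gl m t) (L + 1) := by
  obtain ⟨κ, r, rs, h2, h3, h4⟩ := h
  have hr := r.isLt
  rcases s with ⟨x, η⟩
  rcases t with ⟨y, θ⟩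
  have hxy : e x = !e y := by
    have : e x ≠ e y := fun h => hst (e.injective h)
    cases hx : e x <;> cases hy : e y <;> simp_all
  cases η <;> cases θ <;> simp only [hxy, sylCount, Bool.false_eq_true, Bool.true_eq_false,
    if_true, if_false, Bool.not_not, add_zero] at *
  · refine SyllableState.of_unact (κ := κ) (r := ⟨r.val - 1, by omega⟩) (rs := rs)
      (by omega) h1.le h4 ?_ ?_ ?_
    · rw [h2]; simp [St.Dn]; omega
    · rw [h2]
      have : r.val ≠ 0 := by omega
      simp [St.unact, this]
    · simp only; omega
  · refine SyllableState.of_act (κ := κ) (r := 0) (rs := r :: rs) (by omega) h1.le h4 ?_ ?_ ?_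
    · rw [h2]; simpa [St.Up] using h0
    · rw [h2]; simp [St.act]
    · simp; omega
  · refine SyllableState.of_unact (κ := κ + 1) (r := Fin.last n) (rs := r :: rs)
      (by omega) h1.le h4 ?_ ?_ ?_
    · rw [h2]; simpa [St.Dn] using h1
    · rw [h2]; simp [St.unact]
    · simp only [Fin.val_last]; omega
  · have hrn : r.val < n := by omega
    refine SyllableState.of_act (κ := κ) (r := ⟨r.val + 1, by omega⟩) (rs := rs)
      (by omega) h1.le h4 ?_ ?_ ?_
    · rw [h2]; simp [St.Up]; omega
    · rw [h2]; simp [St.act, hrn]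
    · simp only; push_cast; omega

lemma sylCount_add (s : Y × Bool) : sylCount true s + sylCount false s = 1 := by
  rcases s with ⟨x, _ | _⟩ <;> simp [sylCount]

lemma sylCount_nonneg (b : Bool) (s : Y × Bool) : 0 ≤ sylCount b s := by
  unfold sylCount; split_ifs <;> simp

lemma sgn_eq (s : Y × Bool) : sgn s = 2 * sylCount true s - 1 := by
  rcases s with ⟨x, _ | _⟩ <;> simp [sylCount, sgn]

variable (s₁ s₂ s₃ s₄ : Y × Bool) (a b c : ℕ)

lemma len_four_le : len (gl m s₁ ^ (a + 1) * gl m s₂ ^ (b + 1) * gl m s₃ ^ (c + 1) * gl m s₄)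
    ≤ a + b + c + 4 := by
  have := len_le (m := m) (List.replicate (a + 1) s₁ ++ List.replicate (b + 1) s₂ ++
    List.replicate (c + 1) s₃ ++ [s₄])
  simp only [ev_append, ev_replicate, ev_singleton, List.length_append, List.length_replicate,
    List.length_singleton] at this
  omega

include e hm in
lemma dihedral_len_four (hn : 2 ≤ n) (h₁₂ : s₁.1 ≠ s₂.1) (h₂₃ : s₂.1 ≠ s₃.1)
    (h₃₄ : s₃.1 ≠ s₄.1) :
    len (gl m s₁ ^ (a + 1) * gl m s₂ ^ (b + 1) * gl m s₃ ^ (c + 1) * gl m s₄) = a + b + c + 4 := by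
  apply le_antisymm (len_four_le ..)
  have p1 := sylCount_nonneg true s₁
  have p2 := sylCount_nonneg true s₂
  have p3 := sylCount_nonneg true s₃
  have p4 := sylCount_nonneg true s₄
  have n1 := sylCount_nonneg false s₁
  have n2 := sylCount_nonneg false s₂
  have n3 := sylCount_nonneg false s₃
  have n4 := sylCount_nonneg false s₄
  have q1 := sylCount_add s₁
  have q2 := sylCount_add s₂
  have q3 := sylCount_add s₃
  have q4 := sylCount_add s₄
  by_cases hmix : 1 ≤ sylCount true s₁ + sylCount true s₂ + sylCount true s₃ + sylCount true s₄ ∧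
      sylCount true s₁ + sylCount true s₂ + sylCount true s₃ + sylCount true s₄ < 4
  · obtain ⟨h0, h1⟩ := hmix
    set k := sylCount true s₁ + sylCount true s₂ + sylCount true s₃ + sylCount true s₄ with hk
    have h1' : k < n + 2 := by omega
    have i1 := (SyllableState.first (e := e) (hm := hm) h0 h1' s₁).pow h0 h1' le_rfl le_rfl a
    rw [← pow_succ'] at i1
    have i2 := (i1.next h0 h1' h₁₂ (by omega) (by omega) (by omega) (by omega)).pow h0 h1'
      (by omega) (by omega) b
    rw [mul_assoc _ (gl m s₂), ← pow_succ'] at i2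
    have i3 := (i2.next h0 h1' h₂₃ (by omega) (by omega) (by omega) (by omega)).pow h0 h1'
      (by omega) (by omega) c
    rw [mul_assoc _ (gl m s₃), ← pow_succ'] at i3
    have i4 := i3.next h0 h1' h₃₄ (by omega) (by omega) (by omega) (by omega)
    obtain ⟨-, -, -, -, -, h5⟩ := i4
    have := wt_nf_le e hm (c := k) (by omega) h1'.le
      (gl m s₁ ^ (a + 1) * gl m s₂ ^ (b + 1) * gl m s₃ ^ (c + 1) * gl m s₄)
    rw [h5] at this
    omega
  · have := abs_expSum_le
      (gl m s₁ ^ (a + 1) * gl m s₂ ^ (b + 1) * gl m s₃ ^ (c + 1) * gl m s₄)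
    simp only [map_mul, map_pow, toAdd_mul, toAdd_pow, expSum_gl, sgn_eq, nsmul_eq_mul] at this
    have hcase : (sylCount true s₁ = 0 ∧ sylCount true s₂ = 0 ∧ sylCount true s₃ = 0 ∧
        sylCount true s₄ = 0) ∨ (sylCount true s₁ = 1 ∧ sylCount true s₂ = 1 ∧
        sylCount true s₃ = 1 ∧ sylCount true s₄ = 1) := by omega
    rw [abs_le] at this
    rcases hcase with ⟨r1, r2, r3, r4⟩ | ⟨r1, r2, r3, r4⟩ <;>
      rw [r1, r2, r3, r4] at this <;> push_cast at this <;> omega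

end FourSyllables

section FreeCase

variable {Y : Type*} {m : Y → Y → ℕ∞} (hm : ∀ x y : Y, x ≠ y → m x y = ⊤)

/-- An Artin group all of whose labels are infinite maps to the free group. -/
def toFree : ArtinGroup m →* FreeGroup Y :=
  PresentedGroup.toGroup (f := FreeGroup.of) (by
    rintro r ⟨x, y, k, hxy, hk, rfl⟩
    rw [hm x y hxy] at hk
    exact absurd hk.symm (ENat.natCast_ne_top k))

lemma toFree_ev (w : Word Y) : toFree hm (ev m w) = FreeGroup.mk w := by
  have h : ∀ x : Y, toFree hm (artinGen m x) = FreeGroup.of x :=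
    fun x => PresentedGroup.toGroup.of _
  induction w with
  | nil => rw [ev_nil, map_one, FreeGroup.one_eq_mk]
  | cons s w ih =>
    have h2 : FreeGroup.mk (s :: w) = FreeGroup.mk [s] * FreeGroup.mk w := by
      rw [FreeGroup.mul_mk]; rfl
    rw [ev_cons, map_mul, ih, h2]
    congr 1
    rcases s with ⟨x, b⟩
    cases b
    · simp [gl, h, FreeGroup.of, FreeGroup.inv_mk, FreeGroup.invRev]
    · simp [gl, h, FreeGroup.of]

include hm in
lemma free_geodesic {w : Word Y} (hw : FreeGroup.IsReduced w) : len (ev m w) = w.length := by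
  classical
  apply le_antisymm (len_le w)
  obtain ⟨v, hv, hl⟩ := exists_geodesic (ev m w)
  rw [← hl]
  have h1 : FreeGroup.mk v = FreeGroup.mk w := by rw [← toFree_ev hm, ← toFree_ev hm, hv]
  have h2 : FreeGroup.norm (FreeGroup.mk w) = w.length := by
    rw [FreeGroup.norm, FreeGroup.toWord_mk, hw.reduce_eq]
  rw [← h2, ← h1]
  exact FreeGroup.norm_mk_le

lemma free_exists_reduced (g : ArtinGroup m) :
    ∃ w : Word Y, FreeGroup.IsReduced w ∧ ev m w = g ∧ w.length = len g := by
  obtain ⟨w, hw, hl⟩ := exists_geodesic g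
  refine ⟨w, ?_, hw, hl⟩
  unfold FreeGroup.IsReduced
  rw [List.isChain_iff_forall_rel_of_append_cons_cons]
  rintro ⟨x, b⟩ ⟨y, d⟩ l₁ l₂ rfl h
  simp only at h ⊢
  subst h
  by_contra hne
  have h2 : ev m (l₁ ++ l₂) = g := by
    rw [← hw]
    have : d = !b := by cases b <;> cases d <;> simp_all
    subst this
    simp only [ev_append, ev_cons]
    have := gl_flip (m := m) (x, b)
    simp only [flip] at this
    rw [this, mul_inv_cancel_left]
  have h3 := len_le (m := m) (l₁ ++ l₂)
  rw [h2, ← hl] at h3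
  simp at h3

include hm in
lemma free_desc {g : ArtinGroup m} {w : Word Y} (hr : FreeGroup.IsReduced w) (hw : ev m w = g)
    {s : Y × Bool} (hs : Desc g s) : w.getLast? = some s := by
  by_contra hne
  have h1 : FreeGroup.IsReduced (w ++ [flip s]) := by
    unfold FreeGroup.IsReduced at hr ⊢
    rw [List.isChain_append]
    refine ⟨hr, by simp, fun t ht t' ht' h2 => ?_⟩
    simp only [List.head?_cons, Option.mem_def, Option.some.injEq] at ht' ht
    subst ht'
    rcases eq_or_eq_flip h2 with h3 | h3
    · rw [h3]
    · rw [flip_flip] at h3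
      exact absurd (h3 ▸ ht) hne
  have h2 := free_geodesic hm h1
  have h3 := free_geodesic hm hr
  rw [ev_append, ev_singleton, hw, List.length_append, List.length_singleton] at h2
  rw [hw] at h3
  unfold Desc at hs
  omega

include hm in
lemma free_desc_unique {g : ArtinGroup m} {s t : Y × Bool} (hs : Desc g s) (ht : Desc g t) :
    s = t := by
  obtain ⟨w, hr, hw, -⟩ := free_exists_reduced g
  have h1 := free_desc hm hr hw hs
  rw [free_desc hm hr hw ht] at h1
  exact (Option.some.inj h1).symm

end FreeCase

section TwoGenerators

variable {Y : Type*} {m : Y → Y → ℕ∞}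

lemma len_gl_pow_le (s : Y × Bool) (a : ℕ) : len (gl m s ^ a) ≤ a := by
  have := len_le (m := m) (List.replicate a s)
  simpa [ev_replicate] using this

lemma exists_len_strip (g : ArtinGroup m) (x : Y) : ∃ p ε k, g = p * gl m (x, ε) ^ k ∧
    len g = len p + k ∧ ∀ δ, ¬ Desc p (x, δ) := by
  by_cases h : ∃ δ, Desc g (x, δ)
  · obtain ⟨δ, hδ⟩ := h
    have key : ∀ N (g : ArtinGroup m), len g = N → ∃ p k, g = p * gl m (x, δ) ^ k ∧
        len g = len p + k ∧ ¬ Desc p (x, δ) := by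
      intro N
      induction N with
      | zero =>
        intro g hg
        exact ⟨g, 0, by simp, by simp, fun h => by unfold Desc at h; omega⟩
      | succ N ih =>
        intro g hg
        by_cases h : Desc g (x, δ)
        · have h' := h
          unfold Desc at h'
          obtain ⟨p, k, h1, h2, h3⟩ := ih (g * gl m (flip (x, δ))) (by omega)
          refine ⟨p, k + 1, ?_, by omega, h3⟩
          rw [pow_succ, ← mul_assoc, ← h1, gl_flip, inv_mul_cancel_right]
        · exact ⟨g, 0, by simp, by simp, h⟩
    obtain ⟨p, k, h1, h2, h3⟩ := key _ g rfl
    by_cases h4 : Desc p (x, !δ)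
    · exfalso
      have hk : k ≠ 0 := by
        rintro rfl
        apply h3
        rw [pow_zero, mul_one] at h1
        rwa [← h1]
      obtain ⟨k, rfl⟩ := Nat.exists_eq_succ_of_ne_zero hk
      have h5 : g = (p * gl m (x, δ)) * gl m (x, δ) ^ k := by rw [h1, pow_succ', mul_assoc]
      have h6 := len_mul_le (p * gl m (x, δ)) (gl m (x, δ) ^ k)
      rw [← h5] at h6
      have h7 := len_gl_pow_le (m := m) (x, δ) k
      unfold Desc at h4
      simp only [flip, Bool.not_not] at h4
      omega
    · refine ⟨p, δ, k, h1, h2, fun η hη => ?_⟩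
      cases η <;> cases δ <;> first | exact h3 hη | exact h4 hη
  · push Not at h
    exact ⟨g, true, 0, by simp, by simp, h⟩

lemma eq_one_of_no_desc (e : Y ≃ Bool) {x y : Y} (hxy : x ≠ y) {g : ArtinGroup m}
    (hx : ∀ δ, ¬ Desc g (x, δ)) (hy : ∀ δ, ¬ Desc g (y, δ)) : g = 1 := by
  by_contra h
  obtain ⟨⟨z, δ⟩, u, rfl, hl⟩ := exists_desc h
  have hd := desc_mul_gl.mpr hl
  have h1 : e x ≠ e y := fun h => hxy (e.injective h)
  have h2 : e z = e x ∨ e z = e y := by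
    cases hx' : e x <;> cases hy' : e y <;> cases hz' : e z <;> simp_all
  rcases h2 with h2 | h2
  · obtain rfl := e.injective h2
    exact hx _ hd
  · obtain rfl := e.injective h2
    exact hy _ hd

variable {k : ℕ∞}

lemma not_desc_flip (e : Y ≃ Bool) (hm : ∀ x y : Y, x ≠ y → m x y = k) (hk : 2 ≤ k)
    (g : ArtinGroup m) (s : Y × Bool) : ¬ (Desc g s ∧ Desc g (flip s)) := by
  induction k using ENat.recTopCoe with
  | top => exact fun ⟨h1, h2⟩ => flip_ne s (free_desc_unique hm h1 h2).symm
  | coe k =>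
    obtain ⟨n, rfl⟩ := Nat.exists_eq_add_of_le' (Nat.ofNat_le_cast.mp hk)
    exact dihedral_not_desc_flip e hm g s

lemma pos_of_strip {g p : ArtinGroup m} {x : Y} {ε : Bool} {k : ℕ} (h : g = p * gl m (x, ε) ^ k)
    {t : Y × Bool} (ht : Desc g t) (htx : t.1 = x) (hp : ∀ δ, ¬ Desc p (x, δ)) : k ≠ 0 := by
  rintro rfl
  rw [pow_zero, mul_one] at h
  subst h htx
  exact hp _ ht

lemma desc_strips (e : Y ≃ Bool) (hm : ∀ x y : Y, x ≠ y → m x y = k) (hk : 2 ≤ k) (hk2 : k ≠ 2)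
    (hk3 : k ≠ 3) {u : ArtinGroup m} {s t : Y × Bool} (hs : Desc u s) (ht : Desc u t)
    (hst : s.1 ≠ t.1)
    {p₁ p₂ p₃ : ArtinGroup m} {ε₁ ε₂ ε₃ : Bool} {k₁ k₂ k₃ : ℕ}
    (h₁ : u = p₁ * gl m (t.1, ε₁) ^ k₁) (l₁ : len u = len p₁ + k₁) (n₁ : ∀ δ, ¬ Desc p₁ (t.1, δ))
    (h₂ : p₁ = p₂ * gl m (s.1, ε₂) ^ k₂) (l₂ : len p₁ = len p₂ + k₂)
    (n₂ : ∀ δ, ¬ Desc p₂ (s.1, δ))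
    (h₃ : p₂ = p₃ * gl m (t.1, ε₃) ^ k₃) (l₃ : len p₂ = len p₃ + k₃)
    (n₃ : ∀ δ, ¬ Desc p₃ (t.1, δ)) :
    (∃ δ, Desc p₁ (s.1, δ)) ∧ (∃ δ, Desc p₂ (t.1, δ)) ∧ (∃ δ, Desc p₃ (s.1, δ)) := by
  induction k using ENat.recTopCoe with
  | top => exact absurd (congrArg Prod.fst (free_desc_unique hm hs ht)) hst
  | coe k =>
    have hk' : 2 ≤ k := Nat.ofNat_le_cast.mp hk
    obtain ⟨n, rfl⟩ := Nat.exists_eq_add_of_le' hk'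
    have hn : 2 ≤ n := by
      have h2 : n + 2 ≠ 2 := fun h => hk2 (by rw [h]; rfl)
      have h3 : n + 2 ≠ 3 := fun h => hk3 (by rw [h]; rfl)
      omega
    have four : ∀ (δ₁ δ₂ δ₃ δ₄ : Bool) (a b c : ℕ), len (gl m (t.1, δ₁) ^ (a + 1) *
        gl m (s.1, δ₂) ^ (b + 1) * gl m (t.1, δ₃) ^ (c + 1) * gl m (s.1, δ₄)) = a + b + c + 4 :=
      fun δ₁ δ₂ δ₃ δ₄ a b c => dihedral_len_four (e := e) (hm := hm) (t.1, δ₁) (s.1, δ₂) (t.1, δ₃) (s.1, δ₄)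
        a b c hn hst.symm hst hst.symm
    have k1 := pos_of_strip h₁ ht rfl n₁
    obtain ⟨c, rfl⟩ := Nat.exists_eq_succ_of_ne_zero k1
    have hs' : len (u * gl m (s.1, !s.2)) + 1 = len u := hs
    have d1 : ∃ δ, Desc p₁ (s.1, δ) := by
      by_contra! hcon
      have hp := eq_one_of_no_desc e hst hcon n₁
      have h4 := four true true ε₁ (!s.2) 0 0 c
      have h5 := len_mul_le (gl m (t.1, true) * gl m (s.1, true)) (u * gl m (s.1, !s.2))
      have h6 := len_mul_le (gl m (t.1, true)) (gl m (s.1, true))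
      rw [hp, one_mul] at h₁
      rw [hp, len_one] at l₁
      have h7 : gl m (t.1, true) * gl m (s.1, true) * (u * gl m (s.1, !s.2)) = gl m (t.1, true) ^
          (0 + 1) * gl m (s.1, true) ^ (0 + 1) * gl m (t.1, ε₁) ^ (c + 1) * gl m (s.1, !s.2) := by
        rw [h₁]; simp only [zero_add, pow_one, mul_assoc]
      rw [h7, h4] at h5
      simp only [len_gl] at h6
      omega
    obtain ⟨δ₁, hδ₁⟩ := d1
    have k2 := pos_of_strip h₂ hδ₁ rfl n₂
    obtain ⟨b, rfl⟩ := Nat.exists_eq_succ_of_ne_zero k2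
    have d2 : ∃ δ, Desc p₂ (t.1, δ) := by
      by_contra! hcon
      have hp := eq_one_of_no_desc e hst n₂ hcon
      have h4 := four true ε₂ ε₁ (!s.2) 0 b c
      have h5 := len_mul_le (gl m (t.1, true)) (u * gl m (s.1, !s.2))
      rw [hp, one_mul] at h₂
      rw [hp, len_one] at l₂
      have h7 : gl m (t.1, true) * (u * gl m (s.1, !s.2)) = gl m (t.1, true) ^ (0 + 1) *
          gl m (s.1, ε₂) ^ (b + 1) * gl m (t.1, ε₁) ^ (c + 1) * gl m (s.1, !s.2) := by
        rw [h₁, h₂]; simp only [zero_add, pow_one, mul_assoc]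
      rw [h7, h4, len_gl] at h5
      omega
    obtain ⟨δ₂, hδ₂⟩ := d2
    have k3 := pos_of_strip h₃ hδ₂ rfl n₃
    obtain ⟨a, rfl⟩ := Nat.exists_eq_succ_of_ne_zero k3
    refine ⟨⟨δ₁, hδ₁⟩, ⟨δ₂, hδ₂⟩, ?_⟩
    by_contra! hcon
    have hp := eq_one_of_no_desc e hst hcon n₃
    have h4 := four ε₃ ε₂ ε₁ (!s.2) a b c
    rw [hp, one_mul] at h₃
    rw [hp, len_one] at l₃
    have h7 : u * gl m (s.1, !s.2) = gl m (t.1, ε₃) ^ (a + 1) *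
        gl m (s.1, ε₂) ^ (b + 1) * gl m (t.1, ε₁) ^ (c + 1) * gl m (s.1, !s.2) := by
      rw [h₁, h₂, h₃]
    rw [h7, h4] at hs'
    omega

lemma gen_comm {x y : Y} (hxy : x ≠ y) (h : m x y = 2) :
    artinGen m x * artinGen m y = artinGen m y * artinGen m x := by
  have : PresentedGroup.mk (artinRels m) (altProd 2 x y * (altProd 2 y x)⁻¹) = 1 :=
    PresentedGroup.one_of_mem ⟨x, y, 2, hxy, h, rfl⟩
  rw [map_mul, map_inv, mul_inv_eq_one] at this
  simp only [altProd, mul_one, map_mul] at this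
  exact this

lemma gl_comm {s t : Y × Bool} (hst : s.1 ≠ t.1) (h : m s.1 t.1 = 2) :
    gl m s * gl m t = gl m t * gl m s := by
  have h1 : Commute (artinGen m s.1) (artinGen m t.1) := gen_comm hst h
  rcases s with ⟨x, _ | _⟩ <;> rcases t with ⟨y, _ | _⟩ <;>
    simp only [gl, Bool.false_eq_true, if_true, if_false]
  · exact h1.inv_inv
  · exact h1.inv_left
  · exact h1.inv_right
  · exact h1

lemma len_pow_mul_comm (hm : ∀ x y : Y, x ≠ y → m x y = 2) {s t : Y × Bool} (hst : s.1 ≠ t.1)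
    (a : ℕ) : a ≤ len (gl m s ^ a * gl m t) := by
  classical
  let f : Y → Multiplicative ℤ := fun z => if z = s.1 then Multiplicative.ofAdd 1 else 1
  let φ : ArtinGroup m →* Multiplicative ℤ := PresentedGroup.toGroup (f := f) (by
    rintro r ⟨x, y, k, hxy, hk, rfl⟩
    rw [hm x y hxy] at hk
    have : k = 2 := by exact_mod_cast hk.symm
    subst this
    rw [map_mul, map_inv, mul_inv_eq_one]
    simp only [altProd, mul_one, map_mul, FreeGroup.lift_apply_of]
    exact mul_comm _ _)
  have hφ : ∀ z, φ (artinGen m z) = f z := fun z => PresentedGroup.toGroup.of _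
  have hle : ∀ w : Word Y, |(φ (ev m w)).toAdd| ≤ w.length := by
    intro w
    induction w with
    | nil => simp
    | cons u w ih =>
      rw [ev_cons, map_mul, toAdd_mul]
      have h1 : |(φ (gl m u)).toAdd| ≤ 1 := by
        unfold gl
        split_ifs <;> simp only [map_inv, hφ, f] <;> split_ifs <;> simp
      have := abs_add_le (φ (gl m u)).toAdd (φ (ev m w)).toAdd
      push_cast [List.length_cons]
      linarith
  obtain ⟨w, hw, hl⟩ := exists_geodesic (gl m s ^ a * gl m t)
  have h1 := hle w
  rw [hw, hl, map_mul, map_pow] at h1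
  have h2 : φ (gl m t) = 1 := by
    unfold gl
    split_ifs <;> simp [hφ, f, hst.symm]
  have h3 : |(φ (gl m s)).toAdd| = 1 := by
    unfold gl
    split_ifs <;> simp [hφ, f]
  rw [h2, mul_one, toAdd_pow, nsmul_eq_mul, abs_mul, h3, mul_one] at h1
  simpa using h1

lemma desc_comm (e : Y ≃ Bool) (hm : ∀ x y : Y, x ≠ y → m x y = 2) {u : ArtinGroup m}
    {s t : Y × Bool} (hs : Desc u s) (ht : Desc u t) (hst : s.1 ≠ t.1) :
    Desc (u * gl m (flip s)) t := by
  have hpc : ∀ (δ η : Bool) (a b : ℕ), gl m (s.1, δ) ^ a * gl m (t.1, η) ^ b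
      = gl m (t.1, η) ^ b * gl m (s.1, δ) ^ a := by
    intro δ η a b
    have : Commute (gl m (s.1, δ)) (gl m (t.1, η)) := gl_comm hst (hm _ _ hst)
    exact this.pow_pow a b
  obtain ⟨p, ε, k, h1, l1, n1⟩ := exists_len_strip u s.1
  obtain ⟨q, η, j, h2, l2, n2⟩ := exists_len_strip p t.1
  have hq : q = 1 := by
    refine eq_one_of_no_desc e hst (fun δ hδ => n1 δ ?_) n2
    unfold Desc at hδ ⊢
    have h4 : p * gl m (flip (s.1, δ)) = q * gl m (flip (s.1, δ)) * gl m (t.1, η) ^ j := by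
      have := hpc (!δ) η 1 j
      rw [pow_one] at this
      rw [h2, mul_assoc, mul_assoc]
      congr 1
      exact this.symm
    have h5 := len_mul_le (q * gl m (flip (s.1, δ))) (gl m (t.1, η) ^ j)
    rw [← h4] at h5
    have h6 := len_gl_pow_le (m := m) (t.1, η) j
    have h7 := len_mul_gl p (flip (s.1, δ))
    omega
  subst hq
  rw [len_one, zero_add] at l2
  rw [one_mul] at h2
  subst h2
  have hk := pos_of_strip h1 hs rfl n1
  obtain ⟨k, rfl⟩ := Nat.exists_eq_succ_of_ne_zero hk
  have hj : j ≠ 0 := by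
    rintro rfl
    rw [pow_zero, one_mul] at h1
    have h3 := len_pow_mul_comm hm (s := (s.1, ε)) (t := flip t) (by simpa using hst) (k + 1)
    unfold Desc at ht
    rw [h1] at ht
    have := len_gl_pow_le (m := m) (s.1, ε) (k + 1)
    simp only [Nat.succ_eq_add_one] at ht
    omega
  obtain ⟨j, rfl⟩ := Nat.exists_eq_succ_of_ne_zero hj
  have hs' : Desc u (s.1, ε) := by
    unfold Desc
    rw [h1, pow_succ (gl m (s.1, ε)), gl_flip, ← mul_assoc, mul_inv_cancel_right]
    have h3 := len_mul_le (gl m (t.1, η) ^ (j + 1)) (gl m (s.1, ε) ^ k)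
    have h4 := len_gl_pow_le (m := m) (s.1, ε) k
    have h5 := len_mul_gl (gl m (t.1, η) ^ (j + 1) * gl m (s.1, ε) ^ k) (s.1, ε)
    rw [mul_assoc _ _ (gl m (s.1, ε)), ← pow_succ, ← h1] at h5
    rw [mul_assoc _ _ (gl m (s.1, ε)), ← pow_succ, ← h1]
    simp only [Nat.succ_eq_add_one] at *
    omega
  have hsε : s = (s.1, ε) := by
    rcases eq_or_eq_flip (s := s) (t := (s.1, ε)) rfl with h | h
    · exact h
    · exact absurd ⟨hs', h ▸ hs⟩ (not_desc_flip e hm le_rfl u (s.1, ε))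
  have ht' : Desc u (t.1, η) := by
    unfold Desc
    have h6 : u = gl m (s.1, ε) ^ (k + 1) * gl m (t.1, η) ^ j * gl m (t.1, η) := by
      rw [mul_assoc, ← pow_succ, hpc]
      exact h1
    have h3 := len_mul_le (gl m (s.1, ε) ^ (k + 1)) (gl m (t.1, η) ^ j)
    have h4 := len_gl_pow_le (m := m) (t.1, η) j
    have h7 := len_gl_pow_le (m := m) (s.1, ε) (k + 1)
    have h5 := len_mul_gl (gl m (s.1, ε) ^ (k + 1) * gl m (t.1, η) ^ j) (t.1, η)
    rw [← h6] at h5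
    have h8 : u * gl m (flip (t.1, η)) = gl m (s.1, ε) ^ (k + 1) * gl m (t.1, η) ^ j := by
      rw [h6, gl_flip, mul_inv_cancel_right]
    rw [h8]
    simp only [Nat.succ_eq_add_one] at *
    omega
  have htη : t = (t.1, η) := by
    rcases eq_or_eq_flip (s := t) (t := (t.1, η)) rfl with h | h
    · exact h
    · exact absurd ⟨ht', h ▸ ht⟩ (not_desc_flip e hm le_rfl u (t.1, η))
  have h8 : u * gl m (flip s) * gl m (flip t) = gl m (s.1, ε) ^ k * gl m (t.1, η) ^ j := by
    have h6 : u = gl m (s.1, ε) ^ k * gl m (t.1, η) ^ j * gl m (t.1, η) * gl m (s.1, ε) := by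
      rw [mul_assoc _ _ (gl m (t.1, η)), ← pow_succ, hpc, mul_assoc, ← pow_succ]
      exact h1
    rw [h6, gl_flip, gl_flip, ← hsε, mul_inv_cancel_right, ← htη, mul_inv_cancel_right]
  have h3 := len_mul_le (gl m (s.1, ε) ^ k) (gl m (t.1, η) ^ j)
  have h4 := len_gl_pow_le (m := m) (t.1, η) j
  have h7 := len_gl_pow_le (m := m) (s.1, ε) k
  have h9 := len_mul_gl (u * gl m (flip s)) (flip t)
  unfold Desc at hs ⊢
  rw [h8] at *
  simp only [Nat.succ_eq_add_one] at *
  omega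

end TwoGenerators

section Monoid

variable {X : Type*} (m : X → X → ℕ∞)

/-- The labelling restricted to a set of generators. -/
abbrev sub (T : Set X) : T → T → ℕ∞ := fun a b => m a b

/-- A two-element set of generators. -/
def IsPair (T : Set X) : Prop := ∃ x y, x ≠ y ∧ T = {x, y}

/-- The inclusion of letters. -/
def inc {T : Set X} (s : T × Bool) : X × Bool := (s.1, s.2)

/-- Replacing a geodesic subword in two generators by an equal one. -/
inductive Step : Word X → Word X → Prop
  | mk (p q : Word X) (T : Set X) (hT : IsPair T) (u v : Word T)
      (hu : u.length = len (ev (sub m T) u)) (hv : v.length = len (ev (sub m T) v))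
      (huv : ev (sub m T) u = ev (sub m T) v) : Step (p ++ u.map inc ++ q) (p ++ v.map inc ++ q)

/-- The congruence on words generated by dihedral geodesic replacements. -/
def wordCon : Con (FreeMonoid (X × Bool)) where
  r u v := Relation.EqvGen (Step m) u.toList v.toList
  iseqv := ⟨fun _ => .refl _, fun h => .symm _ _ h, fun h h' => .trans _ _ _ h h'⟩
  mul' := by
    have left : ∀ (p : Word X) {a b : Word X}, Relation.EqvGen (Step m) a b →
        Relation.EqvGen (Step m) (p ++ a) (p ++ b) := by
      intro p a b h
      induction h with
      | rel a b h =>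
        obtain ⟨p', q, T, hT, u, v, hu, hv, huv⟩ := h
        have := Step.mk (p ++ p') q T hT u v hu hv huv
        simp only [List.append_assoc] at this ⊢
        exact .rel _ _ this
      | refl a => exact .refl _
      | symm a b _ ih => exact .symm _ _ ih
      | trans a b c _ _ ih ih' => exact .trans _ _ _ ih ih'
    have right : ∀ (q : Word X) {a b : Word X}, Relation.EqvGen (Step m) a b →
        Relation.EqvGen (Step m) (a ++ q) (b ++ q) := by
      intro q a b h
      induction h with
      | rel a b h =>
        obtain ⟨p, q', T, hT, u, v, hu, hv, huv⟩ := h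
        have := Step.mk p (q' ++ q) T hT u v hu hv huv
        simp only [List.append_assoc] at this ⊢
        exact .rel _ _ this
      | refl a => exact .refl _
      | symm a b _ ih => exact .symm _ _ ih
      | trans a b c _ _ ih ih' => exact .trans _ _ _ ih ih'
    intro a b c d h h'
    exact .trans _ _ _ (right _ h) (left _ h')

/-- The monoid of words modulo dihedral geodesic replacements. -/
abbrev Mon : Type _ := (wordCon m).Quotient

/-- The class of a word. -/
def cls (w : Word X) : Mon m := ((FreeMonoid.ofList w : FreeMonoid (X × Bool)) : (wordCon m).Quotient)

/-- The class of a letter. -/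
def lt (s : X × Bool) : Mon m := cls m [s]

variable {m}

@[simp] lemma cls_nil : cls m [] = 1 := rfl

@[simp] lemma cls_append (u v : Word X) : cls m (u ++ v) = cls m u * cls m v := rfl

lemma cls_cons (s : X × Bool) (w : Word X) : cls m (s :: w) = lt m s * cls m w := rfl

lemma cls_concat (w : Word X) (s : X × Bool) : cls m (w ++ [s]) = cls m w * lt m s := rfl

lemma cls_surjective (g : Mon m) : ∃ w, cls m w = g := by
  induction g using Con.induction_on with
  | H w => exact ⟨w.toList, rfl⟩

lemma cls_eq_iff {u v : Word X} : cls m u = cls m v ↔ Relation.EqvGen (Step m) u v :=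
  Con.eq (wordCon m)

lemma Step.length_eq {u v : Word X} (h : Step m u v) : u.length = v.length := by
  obtain ⟨p, q, T, hT, u, v, hu, hv, huv⟩ := h
  simp only [List.length_append, List.length_map, hu, hv, huv]

/-- Length in the monoid of words. -/
def ln (g : Mon m) : ℕ := Con.liftOn g (fun w => w.toList.length) (by
  intro a b h
  change Relation.EqvGen (Step m) a.toList b.toList at h
  generalize a.toList = a' at h ⊢
  generalize b.toList = b' at h ⊢
  induction h with
  | rel a b h => exact h.length_eq
  | refl a => rfl
  | symm a b _ ih => exact ih.symm
  | trans a b c _ _ ih ih' => exact ih.trans ih')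

@[simp] lemma ln_cls (w : Word X) : ln (cls m w) = w.length := rfl

@[simp] lemma ln_mul (g h : Mon m) : ln (g * h) = ln g + ln h := by
  obtain ⟨u, rfl⟩ := cls_surjective g
  obtain ⟨v, rfl⟩ := cls_surjective h
  rw [← cls_append, ln_cls, ln_cls, ln_cls, List.length_append]

@[simp] lemma ln_one : ln (1 : Mon m) = 0 := rfl

@[simp] lemma ln_lt (s : X × Bool) : ln (lt m s) = 1 := rfl

@[simp] lemma ln_lt_pow (s : X × Bool) (k : ℕ) : ln (lt m s ^ k) = k := by
  induction k with
  | zero => simp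
  | succ k ih => rw [pow_succ, ln_mul, ih, ln_lt]

/-- Elements without a factor `s s⁻¹`. -/
def Red (g : Mon m) : Prop := ∀ a s b, g ≠ a * lt m s * lt m (flip s) * b

lemma Red.left {g h : Mon m} (hr : Red (g * h)) : Red g := by
  intro a s b hg
  exact hr a s (b * h) (by rw [hg, mul_assoc])

lemma Red.right {g h : Mon m} (hr : Red (g * h)) : Red h := by
  intro a s b hg
  exact hr (g * a) s b (by rw [hg]; simp only [mul_assoc])

section Embedding

variable {T : Set X}

/-- The map from the Artin group on two generators to the monoid of words. -/
noncomputable def emb (u : ArtinGroup (sub m T)) : Mon m :=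
  cls m ((exists_geodesic u).choose.map inc)

lemma emb_ev (hT : IsPair T) {w : Word T} (hw : w.length = len (ev (sub m T) w)) :
    emb (ev (sub m T) w) = cls m (w.map inc) := by
  have h := (exists_geodesic (ev (sub m T) w)).choose_spec
  refine cls_eq_iff.mpr (.rel _ _ ?_)
  have := Step.mk (m := m) [] [] T hT _ w (by rw [h.1, h.2]) hw h.1
  simpa using this

@[simp] lemma ln_emb (u : ArtinGroup (sub m T)) : ln (emb u) = len u := by
  rw [emb, ln_cls, List.length_map]
  exact (exists_geodesic u).choose_spec.2

lemma emb_mul (hT : IsPair T) {u v : ArtinGroup (sub m T)} (h : len (u * v) = len u + len v) :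
    emb (u * v) = emb u * emb v := by
  obtain ⟨w, rfl, hl⟩ := exists_geodesic u
  obtain ⟨w', rfl, hl'⟩ := exists_geodesic v
  rw [← ev_append, emb_ev hT, emb_ev hT hl, emb_ev hT hl', List.map_append, cls_append]
  rw [ev_append, h, List.length_append, hl, hl']

lemma emb_one (hT : IsPair T) : emb (1 : ArtinGroup (sub m T)) = 1 := by
  have := emb_ev (m := m) hT (w := []) (by simp)
  simpa using this

lemma emb_gl (hT : IsPair T) (s : T × Bool) : emb (gl (sub m T) s) = lt m (inc s) := by
  have := emb_ev (m := m) hT (w := [s]) (by simp)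
  rw [ev_singleton] at this
  exact this

lemma emb_mul_gl (hT : IsPair T) {u : ArtinGroup (sub m T)} {s : T × Bool}
    (h : len (u * gl _ s) = len u + 1) : emb (u * gl _ s) = emb u * lt m (inc s) := by
  rw [emb_mul hT (by rw [h, len_gl]), emb_gl hT]

lemma emb_of_desc (hT : IsPair T) {u : ArtinGroup (sub m T)} {s : T × Bool} (h : Desc u s) :
    emb u = emb (u * gl _ (flip s)) * lt m (inc s) := by
  have h1 : u = u * gl _ (flip s) * gl _ s := by rw [gl_flip, inv_mul_cancel_right]
  have h2 := emb_mul_gl hT (u := u * gl _ (flip s)) (s := s) (by rw [← h1]; exact h.symm)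
  rwa [← h1] at h2

lemma inc_flip (s : T × Bool) : inc (flip s) = flip (inc s) := rfl

lemma inc_injective : Function.Injective (inc : T × Bool → X × Bool) := by
  rintro ⟨⟨x, hx⟩, b⟩ ⟨⟨y, hy⟩, c⟩ h
  simpa [inc] using h

lemma len_of_red (hT : IsPair T) {a : Mon m} {u : ArtinGroup (sub m T)} {s : T × Bool}
    (h : Red (a * emb u * lt m (inc s))) : len (u * gl _ s) = len u + 1 := by
  rw [← not_desc_iff]
  intro hd
  apply h (a * emb (u * gl _ (flip (flip s)))) (flip (inc s)) 1
  simp only [emb_of_desc hT hd, inc_flip, flip_flip, mul_one, ← mul_assoc]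

lemma len_mul_of_red (hT : IsPair T) {a : Mon m} {u v : ArtinGroup (sub m T)}
    (h : Red (a * emb u * emb v)) : len (u * v) = len u + len v := by
  obtain ⟨w, rfl, hl⟩ := exists_geodesic v
  induction w using List.reverseRecOn with
  | nil => simp
  | append_singleton w s ih =>
    rw [ev_append, ev_singleton] at *
    rw [List.length_append, List.length_singleton] at hl
    have h1 := len_le (m := sub m T) w
    have h2 := len_mul_gl (ev (sub m T) w) s
    have h3 : w.length = len (ev (sub m T) w) := by omega
    rw [emb_mul_gl hT (by omega), ← mul_assoc] at h
    have h4 := ih h.left h3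
    rw [mul_assoc a, ← emb_mul hT h4] at h
    have h5 := len_of_red hT h
    rw [← mul_assoc, h5, h4, ← hl, ← h3]
    omega

lemma emb_mul_of_red (hT : IsPair T) {a : Mon m} {u v : ArtinGroup (sub m T)}
    (h : Red (a * emb u * emb v)) : emb (u * v) = emb u * emb v :=
  emb_mul hT (len_mul_of_red hT h)

/-- No generator in `T` is a last letter. -/
def Tmin (T : Set X) (h : Mon m) : Prop := ∀ g' s, s.1 ∈ T → h ≠ g' * lt m s

lemma exists_gate (hT : IsPair T) {g : Mon m} (hg : Red g) :
    ∃ (h : Mon m) (u : ArtinGroup (sub m T)), g = h * emb u ∧ Tmin T h := by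
  have key : ∀ (N : ℕ) (h : Mon m) (u : ArtinGroup (sub m T)), ln h = N → g = h * emb u →
      ∃ (h : Mon m) (u : ArtinGroup (sub m T)), g = h * emb u ∧ Tmin T h := by
    intro N
    induction N with
    | zero =>
      intro h u hN hgu
      refine ⟨h, u, hgu, fun g' s _ h1 => ?_⟩
      rw [h1, ln_mul, ln_lt] at hN
      omega
    | succ N ih =>
      intro h u hN hgu
      by_cases hmin : Tmin T h
      · exact ⟨h, u, hgu, hmin⟩
      · unfold Tmin at hmin
        push Not at hmin
        obtain ⟨g', s, hs, h1⟩ := hmin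
        have h2 : lt m s = emb (gl (sub m T) (⟨s.1, hs⟩, s.2)) := (emb_gl (m := m) hT (⟨s.1, hs⟩, s.2)).symm
        rw [h1, h2] at hgu
        refine ih g' (gl (sub m T) (⟨s.1, hs⟩, s.2) * u) ?_ ?_
        · rw [h1, ln_mul, ln_lt] at hN
          omega
        · rw [emb_mul_of_red hT (hgu ▸ hg), hgu, mul_assoc]
  exact key _ g 1 rfl (by rw [emb_one hT, mul_one])

end Embedding

end Monoid

section Relations

variable {X : Type*} {m : X → X → ℕ∞}

/-- The labelling is symmetric, has labels at least `2`, and no label is `3`. -/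
structure ThreeFree (m : X → X → ℕ∞) : Prop where
  symm : ∀ x y, m x y = m y x
  ge_two : ∀ x y, x ≠ y → 2 ≤ m x y
  ne_three : ∀ x y, x ≠ y → m x y ≠ 3

section Pair

variable {T : Set X}

lemma IsPair.eq (hT : IsPair T) {x y : X} (hx : x ∈ T) (hy : y ∈ T) (hxy : x ≠ y) :
    T = {x, y} := by
  obtain ⟨a, b, hab, rfl⟩ := hT
  rcases hx with rfl | rfl <;> rcases hy with rfl | rfl
  · exact absurd rfl hxy
  · rfl
  · exact Set.pair_comm _ _
  · exact absurd rfl hxy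

lemma IsPair.eq_of_mem {T' : Set X} (hT : IsPair T) (hT' : IsPair T') {x y : X} (hx : x ∈ T)
    (hy : y ∈ T) (hx' : x ∈ T') (hy' : y ∈ T') (hxy : x ≠ y) : T = T' :=
  (hT.eq hx hy hxy).trans (hT'.eq hx' hy' hxy).symm

lemma IsPair.equiv (hT : IsPair T) : Nonempty (T ≃ Bool) := by
  obtain ⟨a, b, hab, rfl⟩ := hT
  have h : Nat.card ({a, b} : Set X) = 2 := by
    rw [Nat.card_coe_set_eq, Set.ncard_pair hab]
  have : Finite ({a, b} : Set X) := Nat.finite_of_card_ne_zero (by omega)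
  exact Finite.card_eq.mp (by rw [h]; simp)

lemma IsPair.label (H : ThreeFree m) (hT : IsPair T) {a b : T} (hab : a ≠ b) (c d : T)
    (hcd : c ≠ d) : sub m T c d = m a b := by
  have ha := a.2
  have hb := b.2
  have hab' : (a : X) ≠ b := fun h => hab (Subtype.ext h)
  have hcd' : (c : X) ≠ d := fun h => hcd (Subtype.ext h)
  change m c d = m a b
  have hT' := Set.ext_iff.mp (hT.eq ha hb hab')
  have hc : (c : X) = a ∨ (c : X) = b := (hT' c).mp c.2
  have hd : (d : X) = a ∨ (d : X) = b := (hT' d).mp d.2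
  rcases hc with hc | hc <;> rcases hd with hd | hd
  · exact absurd (hc.trans hd.symm) hcd'
  · rw [hc, hd]
  · rw [hc, hd]
    exact H.symm _ _
  · exact absurd (hc.trans hd.symm) hcd'

lemma pair_not_desc_flip (H : ThreeFree m) (hT : IsPair T) (u : ArtinGroup (sub m T))
    (s : T × Bool) : ¬ (Desc u s ∧ Desc u (flip s)) := by
  obtain ⟨e⟩ := hT.equiv
  have hab : e.symm true ≠ e.symm false := fun h => by simpa using e.symm.injective h
  refine not_desc_flip e (hT.label H hab) ?_ u s
  exact H.ge_two _ _ fun h => hab (Subtype.ext h)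

lemma eq_of_desc (H : ThreeFree m) (hT : IsPair T) {u : ArtinGroup (sub m T)} {s t : T × Bool}
    (hs : Desc u s) (ht : Desc u t) (hst : s.1 = t.1) : s = t := by
  rcases eq_or_eq_flip hst with h | h
  · exact h
  · subst h
    exact absurd ⟨ht, hs⟩ (pair_not_desc_flip H hT u t)

lemma mem_inc (s : T × Bool) : (inc s).1 ∈ T := s.1.2

lemma inc_ne {s t : T × Bool} (h : s.1 ≠ t.1) : (inc s).1 ≠ (inc t).1 :=
  fun h' => h (Subtype.ext h')

lemma exists_inc {s : X × Bool} (hs : s.1 ∈ T) : ∃ s' : T × Bool, inc s' = s :=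
  ⟨(⟨s.1, hs⟩, s.2), rfl⟩

end Pair

/-- Two last letters with different names, and the factors in front of them, related through a
two-generator element. -/
def CrD (g₁ : Mon m) (s : X × Bool) (g₂ : Mon m) (t : X × Bool) : Prop :=
  ∃ (T : Set X) (_ : IsPair T) (s' t' : T × Bool) (h : Mon m) (u₁ u₂ : ArtinGroup (sub m T)),
    inc s' = s ∧ inc t' = t ∧ s'.1 ≠ t'.1 ∧ g₁ = h * emb u₁ ∧ g₂ = h * emb u₂ ∧
      u₁ * gl _ s' = u₂ * gl _ t' ∧ len (u₁ * gl _ s') = len u₁ + 1 ∧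
      len (u₂ * gl _ t') = len u₂ + 1

/-- Two factorisations with a last letter are equal, or related through a two-generator element. -/
def Cr (g₁ : Mon m) (s : X × Bool) (g₂ : Mon m) (t : X × Bool) : Prop :=
  (g₁ = g₂ ∧ s = t) ∨ CrD g₁ s g₂ t

lemma CrD.symm {g₁ g₂ : Mon m} {s t : X × Bool} (h : CrD g₁ s g₂ t) : CrD g₂ t g₁ s := by
  obtain ⟨T, hT, s', t', h, u₁, u₂, hs, ht, hst, e₁, e₂, e, l₁, l₂⟩ := h
  exact ⟨T, hT, t', s', h, u₂, u₁, ht, hs, hst.symm, e₂, e₁, e.symm, l₂, l₁⟩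

lemma CrD.ne {g₁ g₂ : Mon m} {s t : X × Bool} (h : CrD g₁ s g₂ t) : s.1 ≠ t.1 := by
  obtain ⟨T, hT, s', t', h, u₁, u₂, rfl, rfl, hst, -⟩ := h
  exact inc_ne hst

lemma Cr.symm {g₁ g₂ : Mon m} {s t : X × Bool} (h : Cr g₁ s g₂ t) : Cr g₂ t g₁ s := by
  rcases h with ⟨rfl, rfl⟩ | h
  · exact .inl ⟨rfl, rfl⟩
  · exact .inr h.symm

lemma CrD.mul_eq {g₁ g₂ : Mon m} {s t : X × Bool} (h : CrD g₁ s g₂ t) :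
    g₁ * lt m s = g₂ * lt m t := by
  obtain ⟨T, hT, s', t', h, u₁, u₂, rfl, rfl, hst, rfl, rfl, e, l₁, l₂⟩ := h
  rw [mul_assoc, mul_assoc, ← emb_mul_gl hT l₁, ← emb_mul_gl hT l₂, e]

variable (m) in
/-- Last letters of reduced elements are related, for elements of length at most `n`. -/
def RL (n : ℕ) : Prop := ∀ (g₁ : Mon m) (s : X × Bool) (g₂ : Mon m) (t : X × Bool),
  g₁ * lt m s = g₂ * lt m t → Red (g₁ * lt m s) → ln g₁ < n → Cr g₁ s g₂ t

lemma RL.mono {n k : ℕ} (h : RL m n) (hk : k ≤ n) : RL m k :=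
  fun g₁ s g₂ t e r l => h g₁ s g₂ t e r (l.trans_le hk)

lemma cr_of_step (H : ThreeFree m) {w v : Word X} {s t : X × Bool}
    (h : Step m (w ++ [s]) (v ++ [t])) : Cr (cls m w) s (cls m v) t := by
  generalize ha : w ++ [s] = a at h
  generalize hb : v ++ [t] = b at h
  obtain ⟨p, q, T, hT, x, y, hx, hy, hxy⟩ := h
  rcases List.eq_nil_or_concat q with rfl | ⟨q, r, rfl⟩
  · rw [List.append_nil] at ha hb
    have hl : x.length = y.length := by rw [hx, hy, hxy]
    rcases List.eq_nil_or_concat x with rfl | ⟨x, s', rfl⟩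
    · obtain rfl : y = [] := List.length_eq_zero_iff.mp (by rw [← hl]; rfl)
      rw [← hb] at ha
      obtain ⟨rfl, h⟩ := List.append_inj' ha rfl
      exact .inl ⟨rfl, by simpa using h⟩
    · rcases List.eq_nil_or_concat y with rfl | ⟨y, t', rfl⟩
      · simp at hl
      · simp only [List.concat_eq_append, List.map_append, ← List.append_assoc, List.map_cons,
          List.map_nil] at ha hb
        obtain ⟨rfl, h1⟩ := List.append_inj' ha rfl
        obtain ⟨rfl, h2⟩ := List.append_inj' hb rfl
        obtain rfl : s = inc s' := by simpa using h1
        obtain rfl : t = inc t' := by simpa using h2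
        simp only [List.concat_eq_append, ev_append, ev_singleton, List.length_append,
          List.length_singleton] at hx hy hxy
        have lx := len_le (m := sub m T) x
        have ly := len_le (m := sub m T) y
        have lx' := len_mul_gl (ev (sub m T) x) s'
        have ly' := len_mul_gl (ev (sub m T) y) t'
        have ex : x.length = len (ev (sub m T) x) := by omega
        have ey : y.length = len (ev (sub m T) y) := by omega
        have l₁ : len (ev (sub m T) x * gl _ s') = len (ev (sub m T) x) + 1 := by omega
        have l₂ : len (ev (sub m T) y * gl _ t') = len (ev (sub m T) y) + 1 := by omega
        have c₁ : cls m (p ++ x.map inc) = cls m p * emb (ev (sub m T) x) := by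
          rw [cls_append, emb_ev hT ex]
        have c₂ : cls m (p ++ y.map inc) = cls m p * emb (ev (sub m T) y) := by
          rw [cls_append, emb_ev hT ey]
        by_cases hst : s'.1 = t'.1
        · have d₁ := desc_mul_gl.mpr l₁
          have d₂ := desc_mul_gl.mpr l₂
          rw [← hxy] at d₂
          obtain rfl := eq_of_desc H hT d₁ d₂ hst
          exact .inl ⟨by rw [c₁, c₂, mul_right_cancel hxy], rfl⟩
        · exact .inr ⟨T, hT, s', t', cls m p, _, _, rfl, rfl, hst, c₁, c₂, hxy, l₁, l₂⟩
  · simp only [List.concat_eq_append, ← List.append_assoc] at ha hb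
    obtain ⟨rfl, h1⟩ := List.append_inj' ha rfl
    obtain ⟨rfl, h2⟩ := List.append_inj' hb rfl
    refine .inl ⟨cls_eq_iff.mpr (.rel _ _ (.mk p q T hT x y hx hy hxy)), ?_⟩
    rw [← h2] at h1
    simpa using h1

/-- Transitivity of the relation on last letters, for elements of length `n + 1`. -/
def CrTrans (m : X → X → ℕ∞) (n : ℕ) : Prop := ∀ (g₁ g₂ g₃ : Mon m) (s t r : X × Bool),
  Red (g₂ * lt m t) → ln g₂ = n → Cr g₁ s g₂ t → Cr g₂ t g₃ r → Cr g₁ s g₃ r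

lemma RL.succ (H : ThreeFree m) {n : ℕ} (hn : RL m n) (htr : CrTrans m n) : RL m (n + 1) := by
  have key : ∀ a b : Word X, Relation.EqvGen (Step m) a b → a.length = n + 1 → Red (cls m a) →
      ∀ w s v t, a = w ++ [s] → b = v ++ [t] → Cr (cls m w) s (cls m v) t := by
    intro a b h
    induction h with
    | rel a b h =>
      rintro - - w s v t rfl rfl
      exact cr_of_step H h
    | refl a =>
      rintro - - w s v t rfl h
      obtain ⟨rfl, h1⟩ := List.append_inj' h rfl
      exact .inl ⟨rfl, by simpa using h1⟩
    | symm a b hab ih =>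
      intro hl hr w s v t hw hv
      have e := cls_eq_iff.mpr hab
      refine (ih ?_ (e ▸ hr) v t w s hv hw).symm
      rw [← ln_cls (m := m), e, ln_cls, hl]
    | trans a b c hab _ ih ih' =>
      intro hl hr w s v t hw hv
      have e := cls_eq_iff.mpr hab
      have hlb : b.length = n + 1 := by rw [← ln_cls (m := m), ← e, ln_cls, hl]
      have hrb : Red (cls m b) := e ▸ hr
      rcases List.eq_nil_or_concat b with rfl | ⟨b, r, rfl⟩
      · simp at hlb
      · rw [List.concat_eq_append] at *
        refine htr _ _ _ _ _ _ hrb ?_ (ih hl hr w s b r hw rfl) (ih' hlb hrb b r v t rfl hv)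
        simpa using hlb
  intro g₁ s g₂ t e hr hl
  rcases Nat.lt_succ_iff_lt_or_eq.mp hl with hl | hl
  · exact hn g₁ s g₂ t e hr hl
  · obtain ⟨w, rfl⟩ := cls_surjective g₁
    obtain ⟨v, rfl⟩ := cls_surjective g₂
    rw [← cls_concat, ← cls_concat] at e
    refine key _ _ (cls_eq_iff.mp e) ?_ hr w s v t rfl rfl
    simpa using hl

/-- Uniqueness of the factorisation through a two-generator element, up to length `n`. -/
def GU (m : X → X → ℕ∞) (T : Set X) (n : ℕ) : Prop :=
  ∀ (h h' : Mon m) (u u' : ArtinGroup (sub m T)), Tmin T h → Tmin T h' →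
    h * emb u = h' * emb u' → Red (h * emb u) → ln (h * emb u) ≤ n → h = h' ∧ u = u'

/-- Last letters in `T` come from the two-generator factor, up to length `n`. -/
def GD (m : X → X → ℕ∞) (T : Set X) (n : ℕ) : Prop :=
  ∀ (h g : Mon m) (u : ArtinGroup (sub m T)) (s : T × Bool), Tmin T h →
    h * emb u = g * lt m (inc s) → Red (h * emb u) → ln g < n →
    Desc u s ∧ g = h * emb (u * gl _ (flip s))

lemma emb_split {T : Set X} (hT : IsPair T) {u u₀ : ArtinGroup (sub m T)} {t : T × Bool}
    (h : u = u₀ * gl _ t) (hl : len u = len u₀ + 1) : emb u = emb u₀ * lt m (inc t) := by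
  subst h
  exact emb_mul_gl hT hl

lemma gd_succ {T : Set X} (hT : IsPair T) {n : ℕ} (hRL : RL m (n + 1)) (hGU : GU m T n) :
    GD m T (n + 1) := by
  intro h g u s hmin e hr hl
  have hlen := congrArg ln e
  simp only [ln_mul, ln_emb, ln_lt] at hlen
  suffices hs : ∃ v, u = v * gl _ s ∧ g = h * emb v by
    obtain ⟨v, rfl, rfl⟩ := hs
    rw [gl_flip, mul_inv_cancel_right]
    refine ⟨desc_mul_gl.mpr ?_, rfl⟩
    simp only [ln_mul, ln_emb] at hlen
    omega
  by_cases hu : u = 1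
  · rw [hu, emb_one hT, mul_one] at e
    exact absurd e (hmin g (inc s) s.1.2)
  · obtain ⟨t, u₀, hu₀, hul⟩ := exists_desc hu
    have e' := e
    rw [emb_split hT hu₀ hul, ← mul_assoc] at e'
    have hr' := hr
    rw [emb_split hT hu₀ hul, ← mul_assoc] at hr'
    have hl₀ : ln (h * emb u₀) = ln g := by
      simp only [ln_mul, ln_emb]
      omega
    rcases hRL _ _ _ _ e' hr' (by omega) with ⟨rfl, hst⟩ | hc
    · rw [inc_injective hst] at hu₀
      exact ⟨u₀, hu₀, rfl⟩
    · obtain ⟨T', hT', t', s', h₂, v₁, v₂, ht, hs, hst, e₁, e₂, e₃, l₁, l₂⟩ := hc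
      obtain rfl : T = T' := hT.eq_of_mem hT' (mem_inc t) (mem_inc s) (ht ▸ mem_inc t')
        (hs ▸ mem_inc s') (ht ▸ hs ▸ inc_ne hst)
      obtain rfl := inc_injective ht
      obtain rfl := inc_injective hs
      have hr₁ := hr'.left
      rw [e₁] at hr₁
      obtain ⟨h₃, v, rfl, hmin₃⟩ := exists_gate hT hr₁.left
      have hr₂ : Red g := by
        rw [e] at hr
        exact hr.left
      rw [e₂] at hr₂
      rw [mul_assoc, ← emb_mul_of_red hT hr₁] at e₁
      rw [mul_assoc, ← emb_mul_of_red hT hr₂] at e₂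
      obtain ⟨rfl, rfl⟩ := hGU _ _ _ _ hmin hmin₃ e₁ hr'.left (by omega)
      exact ⟨v * v₂, by rw [hu₀, mul_assoc, e₃, mul_assoc], e₂⟩

lemma gu_succ {T : Set X} (hT : IsPair T) {n : ℕ} (hGD : GD m T (n + 1)) (hGU : GU m T n) :
    GU m T (n + 1) := by
  intro h h' u u' hm hm' e hr hl
  by_cases hu : u = 1
  · by_cases hu' : u' = 1
    · rw [hu, hu'] at e ⊢
      rw [emb_one hT, mul_one, mul_one] at e
      exact ⟨e, rfl⟩
    · obtain ⟨t, u₀, hu₀, hul⟩ := exists_desc hu'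
      rw [emb_split hT hu₀ hul, ← mul_assoc, hu, emb_one hT, mul_one] at e
      exact absurd e (hm _ _ (mem_inc t))
  · obtain ⟨t, u₀, hu₀, hul⟩ := exists_desc hu
    have e' := e
    rw [emb_split hT hu₀ hul, ← mul_assoc] at e'
    have hl₀ : ln (h * emb u₀) + 1 = ln (h * emb u) := by
      simp only [ln_mul, ln_emb]
      omega
    obtain ⟨hd, e₀⟩ := hGD _ _ _ _ hm' e'.symm (e ▸ hr) (by omega)
    have hr₀ := hr
    rw [emb_split hT hu₀ hul, ← mul_assoc] at hr₀
    obtain ⟨rfl, rfl⟩ := hGU _ _ _ _ hm hm' e₀ hr₀.left (by omega)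
    rw [gl_flip, inv_mul_cancel_right] at hu₀
    exact ⟨rfl, hu₀⟩

lemma RL.gu {T : Set X} (hT : IsPair T) : ∀ {n : ℕ}, RL m n → GU m T n
  | 0, _ => by
    intro h h' u u' hm hm' e hr hl
    have hlen := congrArg ln e
    simp only [ln_mul, ln_emb] at hlen hl
    obtain rfl : u = 1 := len_eq_zero.mp (by omega)
    obtain rfl : u' = 1 := len_eq_zero.mp (by omega)
    rw [emb_one hT, mul_one, mul_one] at e
    exact ⟨e, rfl⟩
  | n + 1, hRL => by
    have ih := RL.gu hT (hRL.mono n.le_succ)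
    exact gu_succ hT (gd_succ hT hRL ih) ih

lemma RL.gd {T : Set X} (hT : IsPair T) : ∀ {n : ℕ}, RL m n → GD m T n
  | 0, _ => fun _ _ _ _ _ _ _ hl => absurd hl (Nat.not_lt_zero _)
  | _ + 1, hRL => gd_succ hT hRL (RL.gu hT (hRL.mono (Nat.le_succ _)))

end Relations

section Strips

variable {X : Type*} {m : X → X → ℕ∞}

/-- `y` is the name of a last letter of `g`. -/
def Dn (y : X) (g : Mon m) : Prop := ∃ (s : X × Bool) (g' : Mon m), s.1 = y ∧ g = g' * lt m s

/-- `p` is obtained from `g` by removing a maximal power of `y` on the right. -/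
def IsStrip (y : X) (g p : Mon m) : Prop :=
  (∃ (s : X × Bool) (k : ℕ), s.1 = y ∧ g = p * lt m s ^ k) ∧ ¬ Dn y p

lemma Dn.mul_lt (g : Mon m) (s : X × Bool) : Dn s.1 (g * lt m s) := ⟨s, g, rfl, rfl⟩

lemma not_red_flip (g : Mon m) (s : X × Bool) (h : Mon m) :
    ¬ Red (g * lt m (flip s) * lt m s * h) := fun hr =>
  hr g (flip s) h (by rw [flip_flip])

lemma IsStrip.mul_lt {y : X} {g p : Mon m} {s : X × Bool} (h : IsStrip y g p) (hs : s.1 = y)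
    (hr : Red (g * lt m s)) : IsStrip y (g * lt m s) p := by
  obtain ⟨⟨t, k, ht, rfl⟩, hp⟩ := h
  refine ⟨?_, hp⟩
  rcases k with - | k
  · exact ⟨s, 1, hs, by simp⟩
  · rcases eq_or_eq_flip (ht.trans hs.symm) with rfl | rfl
    · exact ⟨t, k + 2, ht, by rw [pow_succ (lt m t) (k + 1), mul_assoc]⟩
    · rw [pow_succ, ← mul_assoc] at hr
      exact absurd (by rwa [mul_one]) (not_red_flip (p * lt m (flip s) ^ k) s 1)

lemma exists_strip (y : X) {g : Mon m} (hr : Red g) : ∃ p, IsStrip y g p := by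
  induction hn : ln g generalizing g with
  | zero =>
    refine ⟨g, ⟨(y, true), 0, rfl, by simp⟩, ?_⟩
    rintro ⟨s, g', -, rfl⟩
    simp at hn
  | succ n ih =>
    by_cases hd : Dn y g
    · obtain ⟨s, g', hs, rfl⟩ := hd
      obtain ⟨p, hp⟩ := ih hr.left (by simpa using hn)
      exact ⟨p, hp.mul_lt hs hr⟩
    · exact ⟨g, ⟨(y, true), 0, rfl, by simp⟩, hd⟩

lemma IsStrip.red {y : X} {g p : Mon m} (h : IsStrip y g p) (hr : Red g) : Red p := by
  obtain ⟨⟨t, k, ht, rfl⟩, hp⟩ := h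
  exact hr.left

lemma IsStrip.le {y : X} {g p : Mon m} (h : IsStrip y g p) : ln p ≤ ln g := by
  obtain ⟨⟨t, k, ht, rfl⟩, hp⟩ := h
  simp

lemma IsStrip.lt_ln {y : X} {g p : Mon m} (h : IsStrip y g p) (hd : Dn y g) : ln p < ln g := by
  obtain ⟨⟨t, k, ht, rfl⟩, hp⟩ := h
  rcases k with - | k
  · rw [pow_zero, mul_one] at hd
    exact absurd hd hp
  · simp

lemma RL.same_name {n : ℕ} (hRL : RL m n) {g₁ g₂ : Mon m} {s t : X × Bool}
    (e : g₁ * lt m s = g₂ * lt m t) (hr : Red (g₁ * lt m s)) (hl : ln g₁ < n) (hst : s.1 = t.1) :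
    g₁ = g₂ ∧ s = t := by
  rcases hRL _ _ _ _ e hr hl with h | h
  · exact h
  · exact absurd hst h.ne

lemma RL.crD {n : ℕ} (hRL : RL m n) {g₁ g₂ : Mon m} {s t : X × Bool}
    (e : g₁ * lt m s = g₂ * lt m t) (hr : Red (g₁ * lt m s)) (hl : ln g₁ < n) (hst : s.1 ≠ t.1) :
    CrD g₁ s g₂ t := by
  rcases hRL _ _ _ _ e hr hl with h | h
  · exact absurd (congrArg Prod.fst h.2) hst
  · exact h

lemma IsStrip.unique {n : ℕ} (hRL : RL m n) {y : X} {g p p' : Mon m} (hr : Red g) (hl : ln g ≤ n)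
    (h : IsStrip y g p) (h' : IsStrip y g p') : p = p' := by
  obtain ⟨⟨s, k, hs, rfl⟩, hp⟩ := h
  obtain ⟨⟨s', k', hs', e⟩, hp'⟩ := h'
  induction k generalizing k' with
  | zero =>
    rw [pow_zero, mul_one] at e
    rcases k' with - | k'
    · simpa using e
    · exact absurd ⟨s', p' * lt m s' ^ k', hs', by rw [e, pow_succ, mul_assoc]⟩ hp
  | succ k ih =>
    rcases k' with - | k'
    · rw [pow_zero, mul_one] at e
      exact absurd ⟨s, p * lt m s ^ k, hs, by rw [← e, pow_succ, mul_assoc]⟩ hp'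
    · rw [pow_succ, pow_succ, ← mul_assoc, ← mul_assoc] at e
      rw [pow_succ, ← mul_assoc] at hr
      simp only [ln_mul, ln_lt_pow] at hl
      have := hRL.same_name e hr (by simp only [ln_mul, ln_lt_pow]; omega) (hs.trans hs'.symm)
      exact ih hr.left (by simp only [ln_mul, ln_lt_pow]; omega) k' this.1

section Gate

variable {T : Set X}

lemma cls_replicate (s : X × Bool) (k : ℕ) : cls m (List.replicate k s) = lt m s ^ k := by
  induction k with
  | zero => simp
  | succ k ih => rw [List.replicate_succ, cls_cons, ih, pow_succ']

lemma emb_mul_pow (hT : IsPair T) {u : ArtinGroup (sub m T)} {s : T × Bool} {k : ℕ}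
    (h : len (u * gl _ s ^ k) = len u + k) :
    emb (u * gl _ s ^ k) = emb u * lt m (inc s) ^ k := by
  have h1 := len_mul_le u (gl (sub m T) s ^ k)
  have h2 := len_gl_pow_le (m := sub m T) s k
  have h3 : len (gl (sub m T) s ^ k) = k := by omega
  rw [emb_mul hT (by rw [h, h3])]
  congr 1
  rw [← ev_replicate, emb_ev hT (by rw [ev_replicate, h3, List.length_replicate]),
    List.map_replicate, cls_replicate]

lemma Dn.of_desc (hT : IsPair T) (h : Mon m) {u : ArtinGroup (sub m T)} {s : T × Bool}
    (hd : Desc u s) : Dn (s.1 : X) (h * emb u) := by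
  rw [emb_of_desc hT hd, ← mul_assoc]
  exact Dn.mul_lt _ (inc s)

lemma IsStrip.of_gate (hT : IsPair T) {n : ℕ} (hRL : RL m n) {h : Mon m} (hm : Tmin T h)
    {u p : ArtinGroup (sub m T)} {y : T} {ε : Bool} {k : ℕ} (hr : Red (h * emb u))
    (hl : ln (h * emb u) ≤ n) (hu : u = p * gl _ (y, ε) ^ k) (hlen : len u = len p + k)
    (hp : ∀ δ, ¬ Desc p (y, δ)) : IsStrip (y : X) (h * emb u) (h * emb p) := by
  subst hu
  rw [emb_mul_pow hT hlen, ← mul_assoc] at *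
  refine ⟨⟨inc (y, ε), k, rfl, rfl⟩, ?_⟩
  rintro ⟨⟨y', δ⟩, g', rfl, e⟩
  have hlt := congrArg ln e
  simp only [ln_mul, ln_lt, ln_lt_pow] at hlt hl
  exact hp δ (hRL.gd hT h g' p (y, δ) hm e hr.left (by omega)).1

end Gate

lemma CrD.gate {g₁ g₂ : Mon m} {s t : X × Bool} (hc : CrD g₁ s g₂ t) (hr : Red (g₂ * lt m t)) :
    ∃ (T : Set X) (_ : IsPair T) (s' t' : T × Bool) (h : Mon m) (u₁ u₂ : ArtinGroup (sub m T)),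
      Tmin T h ∧ inc s' = s ∧ inc t' = t ∧ s'.1 ≠ t'.1 ∧ g₁ = h * emb u₁ ∧ g₂ = h * emb u₂ ∧
      u₁ * gl _ s' = u₂ * gl _ t' ∧ len (u₁ * gl _ s') = len u₁ + 1 ∧
      len (u₂ * gl _ t') = len u₂ + 1 := by
  have hr₁ : Red (g₁ * lt m s) := hc.mul_eq ▸ hr
  obtain ⟨T, hT, s', t', h, u₁, u₂, rfl, rfl, hst, rfl, rfl, e, -, -⟩ := hc
  obtain ⟨h, v, rfl, hm⟩ := exists_gate hT hr.left.left
  have e₁ := emb_mul_of_red hT hr₁.left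
  have e₂ := emb_mul_of_red hT hr.left
  rw [mul_assoc h _ (emb u₂), ← e₂] at hr ⊢
  rw [mul_assoc h _ (emb u₁), ← e₁] at hr₁ ⊢
  exact ⟨T, hT, s', t', h, v * u₁, v * u₂, hm, rfl, rfl, hst, rfl, rfl,
    by rw [mul_assoc, e, mul_assoc], len_of_red hT hr₁, len_of_red hT hr⟩

lemma CrD.exists_of_comm (H : ThreeFree m) {g₁ g₂ : Mon m} {s t : X × Bool} (hc : CrD g₁ s g₂ t)
    (h2 : m s.1 t.1 = 2) : ∃ h, g₁ = h * lt m t ∧ g₂ = h * lt m s := by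
  obtain ⟨T, hT, s, t, h, u₁, u₂, rfl, rfl, hst, rfl, rfl, e, l₁, l₂⟩ := hc
  obtain ⟨b⟩ := hT.equiv
  have hm : ∀ x y : T, x ≠ y → sub m T x y = 2 := fun x y hxy =>
    (hT.label H hst x y hxy).trans h2
  have d₁ := desc_mul_gl.mpr l₁
  have d₂ := desc_mul_gl.mpr l₂
  have d₃ := desc_comm b hm d₁ (e ▸ d₂) hst
  have d₄ := desc_comm b hm d₂ (e ▸ d₁) hst.symm
  rw [gl_flip, mul_inv_cancel_right] at d₃ d₄
  refine ⟨h * emb (u₁ * gl _ (flip t)), ?_, ?_⟩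
  · rw [mul_assoc, ← emb_of_desc hT d₃]
  · rw [mul_assoc, emb_of_desc hT d₄]
    congr 3
    have hcomm : gl (sub m T) s * gl _ t = gl _ t * gl _ s := gl_comm hst (hm _ _ hst)
    rw [gl_flip, gl_flip, eq_mul_inv_iff_mul_eq, mul_assoc, (Commute.inv_left hcomm).eq, ← mul_assoc,
      ← e, mul_inv_cancel_right]

lemma exists_isPair {x y : X} (hxy : x ≠ y) : ∃ T : Set X, IsPair T ∧ x ∈ T ∧ y ∈ T :=
  ⟨{x, y}, ⟨x, y, hxy, rfl⟩, by simp, by simp⟩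

lemma len_gl_mul_gl (H : ThreeFree m) {T : Set X} (hT : IsPair T) {s t : T × Bool}
    (hst : s.1 ≠ t.1) (h2 : m s.1 t.1 = 2) :
    len (gl (sub m T) s * gl _ t) = len (gl (sub m T) s) + 1 := by
  have hm : ∀ x y : T, x ≠ y → sub m T x y = 2 := fun x y hxy =>
    (hT.label H hst x y hxy).trans h2
  have h1 := len_pow_mul_comm hm hst 1
  have h3 := len_mul_gl (gl (sub m T) s) t
  rw [pow_one] at h1
  rw [len_gl] at h3 ⊢
  omega

lemma lt_comm (H : ThreeFree m) {s t : X × Bool} (hst : s.1 ≠ t.1) (h2 : m s.1 t.1 = 2) :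
    lt m s * lt m t = lt m t * lt m s := by
  obtain ⟨T, hT, hs, ht⟩ := exists_isPair hst
  obtain ⟨s, rfl⟩ := exists_inc hs
  obtain ⟨t, rfl⟩ := exists_inc ht
  have hst' : s.1 ≠ t.1 := fun h => hst (congrArg Subtype.val h)
  have h2' : m t.1 s.1 = 2 := (H.symm _ _).trans h2
  rw [← emb_gl hT s, ← emb_mul_gl hT (len_gl_mul_gl H hT hst' h2), gl_comm hst' h2,
    emb_mul_gl hT (len_gl_mul_gl H hT hst'.symm h2'), emb_gl hT, emb_gl hT]

end Strips

section Transitivity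

variable {X : Type*} {m : X → X → ℕ∞}

lemma CrD.of_comm (H : ThreeFree m) (h : Mon m) {s t : X × Bool} (hst : s.1 ≠ t.1)
    (h2 : m s.1 t.1 = 2) : CrD (h * lt m t) s (h * lt m s) t := by
  obtain ⟨T, hT, hs, ht⟩ := exists_isPair hst
  obtain ⟨s, rfl⟩ := exists_inc hs
  obtain ⟨t, rfl⟩ := exists_inc ht
  have hst' : s.1 ≠ t.1 := fun h => hst (congrArg Subtype.val h)
  have h2' : m t.1 s.1 = 2 := (H.symm _ _).trans h2
  refine ⟨T, hT, s, t, h, gl _ t, gl _ s, rfl, rfl, hst', by rw [emb_gl hT], by rw [emb_gl hT],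
    (gl_comm hst' h2).symm, len_gl_mul_gl H hT hst'.symm h2', len_gl_mul_gl H hT hst' h2⟩

lemma lt_comm_emb (H : ThreeFree m) {T : Set X} (hT : IsPair T) {s : X × Bool}
    (hs : ∀ t : T, s.1 ≠ t ∧ m s.1 t = 2) (u : ArtinGroup (sub m T)) :
    lt m s * emb u = emb u * lt m s := by
  induction hn : len u generalizing u with
  | zero =>
    rw [len_eq_zero.mp hn, emb_one hT, one_mul, mul_one]
  | succ n ih =>
    have hu : u ≠ 1 := by
      rintro rfl
      simp at hn
    obtain ⟨t, v, e, hl⟩ := exists_desc hu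
    rw [emb_split hT e hl, ← mul_assoc, ih v (by omega), mul_assoc,
      lt_comm H (hs t.1).1 (hs t.1).2, mul_assoc]

lemma RL.exists_of_comm (H : ThreeFree m) {n : ℕ} (hRL : RL m n) {T : Set X} (hT : IsPair T)
    {s : X × Bool} (hs : ∀ t : T, s.1 ≠ t ∧ m s.1 t = 2) (u : ArtinGroup (sub m T))
    {h h' : Mon m} (e : h * lt m s = h' * emb u) (hr : Red (h * lt m s)) (hl : ln h < n) :
    ∃ h'', h' = h'' * lt m s ∧ h = h'' * emb u := by
  induction hn : len u generalizing u h with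
  | zero =>
    rw [len_eq_zero.mp hn, emb_one hT, mul_one] at e
    exact ⟨h, e.symm, by rw [len_eq_zero.mp hn, emb_one hT, mul_one]⟩
  | succ k ih =>
    have hu : u ≠ 1 := by
      rintro rfl
      simp at hn
    obtain ⟨t, v, e', hl'⟩ := exists_desc hu
    rw [emb_split hT e' hl', ← mul_assoc] at e
    obtain ⟨k, rfl, e₂⟩ := (hRL.crD e hr hl (hs t.1).1).exists_of_comm H (hs t.1).2
    rw [e, e₂] at hr
    rw [ln_mul, ln_lt] at hl
    obtain ⟨h'', rfl, rfl⟩ := ih v e₂.symm hr.left (by omega) (by omega)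
    exact ⟨h'', rfl, by rw [emb_split hT e' hl', mul_assoc]⟩

lemma Dn.strip_of_comm (H : ThreeFree m) {n : ℕ} (hRL : RL m n) {x y : X} (hxy : x ≠ y)
    (h2 : m x y = 2) {g p : Mon m} (hr : Red g) (hl : ln g ≤ n) (hd : Dn x g)
    (hp : IsStrip y g p) : Dn x p := by
  obtain ⟨⟨s, k, rfl, rfl⟩, -⟩ := hp
  induction k with
  | zero => simpa using hd
  | succ k ih =>
    obtain ⟨t, g', rfl, e⟩ := hd
    rw [pow_succ, ← mul_assoc] at e hr hl
    rw [ln_mul, ln_lt] at hl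
    obtain ⟨h, e₂, -⟩ := (hRL.crD e hr (by omega) hxy.symm).exists_of_comm H
      ((H.symm _ _).trans h2)
    refine ih hr.left (by omega) ?_
    rw [e₂]
    exact Dn.mul_lt _ _

lemma exists_strip_of_mul_lt {T : Set X} (hT : IsPair T) (H : ThreeFree m)
    {u : ArtinGroup (sub m T)} {t : T × Bool} (h : len (u * gl _ t) = len u + 1) :
    ∃ (p : ArtinGroup (sub m T)) (k : ℕ), u = p * gl _ (t.1, t.2) ^ k ∧ len u = len p + k ∧
      ∀ δ, ¬ Desc p (t.1, δ) := by
  obtain ⟨p, ε, k, e, l, hp⟩ := exists_len_strip (u * gl _ t) t.1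
  have hd := desc_mul_gl.mpr h
  obtain ⟨k, rfl⟩ := Nat.exists_eq_succ_of_ne_zero (pos_of_strip e hd rfl hp)
  have h1 := len_mul_le p (gl (sub m T) (t.1, ε) ^ k)
  have h2 := len_gl_pow_le (m := sub m T) (t.1, ε) k
  have hd' : Desc (u * gl _ t) (t.1, ε) := by
    have h3 := len_mul_gl (u * gl _ t) (flip (t.1, ε))
    unfold Desc
    rw [e, pow_succ, gl_flip, ← mul_assoc, mul_inv_cancel_right] at h3 ⊢
    rw [e, pow_succ, ← mul_assoc] at l
    omega
  obtain ⟨x, ε'⟩ := t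
  obtain rfl : ε' = ε := congrArg Prod.snd (eq_of_desc H hT hd hd' rfl)
  rw [pow_succ, ← mul_assoc] at e
  exact ⟨p, k, mul_right_cancel e, by omega, hp⟩

lemma CrD.dn_strips (H : ThreeFree m) {n : ℕ} (hRL : RL m n) {g₁ g₂ : Mon m} {s t : X × Bool}
    (hc : CrD g₁ s g₂ t) (h2 : m s.1 t.1 ≠ 2) (hr : Red (g₂ * lt m t)) (hl : ln g₂ ≤ n)
    {p q r : Mon m} (hp : IsStrip t.1 g₂ p) (hq : IsStrip s.1 p q) (hq' : IsStrip t.1 q r) :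
    Dn s.1 p ∧ Dn t.1 q ∧ Dn s.1 r := by
  obtain ⟨T, hT, s, t, h, u₁, u₂, hm, rfl, rfl, hst, rfl, rfl, e, l₁, l₂⟩ := hc.gate hr
  obtain ⟨b⟩ := hT.equiv
  obtain ⟨p₁, k₁, e₁, j₁, n₁⟩ := exists_strip_of_mul_lt hT H l₂
  obtain ⟨p₂, ε₂, k₂, e₂, j₂, n₂⟩ := exists_len_strip p₁ s.1
  obtain ⟨p₃, ε₃, k₃, e₃, j₃, n₃⟩ := exists_len_strip p₂ t.1
  have hst' : (s.1 : X) ≠ t.1 := fun h => hst (Subtype.ext h)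
  obtain ⟨⟨δ₁, d₁⟩, ⟨δ₂, d₂⟩, ⟨δ₃, d₃⟩⟩ := desc_strips b
    (hT.label H hst) (H.ge_two _ _ hst') h2 (H.ne_three _ _ hst')
    (e ▸ desc_mul_gl.mpr l₁) (desc_mul_gl.mpr l₂) hst
    (k₁ := k₁ + 1) (by rw [e₁, pow_succ, mul_assoc]) (by omega) n₁ e₂ j₂ n₂ e₃ j₃ n₃
  have hr₀ := hr.left
  have s₁ := IsStrip.of_gate hT hRL hm hr₀ hl e₁ j₁ n₁
  have hr₁ := s₁.red hr₀
  have hl₁ := s₁.le.trans hl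
  have s₂ := IsStrip.of_gate hT hRL hm hr₁ hl₁ e₂ j₂ n₂
  have hr₂ := s₂.red hr₁
  have hl₂ := s₂.le.trans hl₁
  have s₃ := IsStrip.of_gate hT hRL hm hr₂ hl₂ e₃ j₃ n₃
  obtain rfl := hp.unique hRL hr₀ hl s₁
  obtain rfl := hq.unique hRL hr₁ hl₁ s₂
  obtain rfl := hq'.unique hRL hr₂ hl₂ s₃
  exact ⟨Dn.of_desc hT h (s := (s.1, δ₁)) d₁, Dn.of_desc hT h (s := (t.1, δ₂)) d₂,
    Dn.of_desc hT h (s := (s.1, δ₃)) d₃⟩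

lemma Dn.strips (H : ThreeFree m) {n : ℕ} (hRL : RL m n) {x y : X} (hxy : x ≠ y) (h2 : m x y ≠ 2)
    {g p q r : Mon m} (hr : Red g) (hl : ln g ≤ n) (hx : Dn x g) (hy : Dn y g)
    (hp : IsStrip y g p) (hq : IsStrip x p q) (hq' : IsStrip y q r) :
    Dn x p ∧ Dn y q ∧ Dn x r := by
  obtain ⟨s, g₁, rfl, rfl⟩ := hx
  obtain ⟨t, g₂, rfl, e⟩ := hy
  have hr' := hr
  have hl' := hl
  rw [e] at hr' hl'
  rw [ln_mul, ln_lt] at hl hl'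
  obtain ⟨p', hp'⟩ := exists_strip t.1 hr'.left
  have hp'' := hp'.mul_lt rfl hr'
  rw [← e] at hp''
  obtain rfl := hp.unique hRL hr (by simpa using hl) hp''
  exact (hRL.crD e hr (by omega) hxy).dn_strips H hRL h2 hr' (by omega) hp' hq hq'

lemma not_dn_three (H : ThreeFree m) {n : ℕ} (hRL : RL m n) {g p : Mon m} {x y z : X}
    (hxy : x ≠ y) (hxz : x ≠ z) (hyz : y ≠ z) (h2 : m x y ≠ 2) (h2' : m x z ≠ 2) (hr : Red g)
    (hl : ln g ≤ n) (hx : Dn x g) (hy : Dn y g) (hp : IsStrip x g p) : ¬ Dn z p := by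
  intro hz
  induction hk : ln g using Nat.strong_induction_on generalizing g p x y z with
  | _ k ih =>
    subst hk
    have hrp := hp.red hr
    have hlp := hp.le.trans hl
    obtain ⟨q, hq⟩ := exists_strip y hrp
    have hrq := hq.red hrp
    have hlq := hq.le.trans hlp
    obtain ⟨r, hr'⟩ := exists_strip x hrq
    have hyx : m y x ≠ 2 := H.symm x y ▸ h2
    obtain ⟨d₁, d₂, d₃⟩ := Dn.strips H hRL hxy.symm hyx hr hl hy hx hp hq hr'
    have hlt := hp.lt_ln hx
    by_cases hc : m y z = 2
    · have hzq : Dn z q := Dn.strip_of_comm H hRL hyz.symm ((H.symm _ _).trans hc) hrp hlp hz hq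
      exact ih _ (hq.le.trans_lt hlt) hxz hxy hyz.symm h2' h2 hrq hlq d₂ hzq hr' d₃ rfl
    · exact ih _ hlt hyz hxy.symm hxz.symm hc hyx hrp hlp d₁ hz hq d₂ rfl

section Cases

variable {n : ℕ} {g₁ g₂ g₃ : Mon m} {s t r : X × Bool}

lemma cr_trans_same (H : ThreeFree m) (hRL : RL m n) (hr : Red (g₂ * lt m t)) (hl : ln g₂ ≤ n)
    (h : CrD g₁ s g₂ t) (h' : CrD g₂ t g₃ r) (hsr : s.1 = r.1) : Cr g₁ s g₃ r := by
  obtain ⟨T, hT, s', t', k, u₁, u₂, hm, hs', ht', hst, e₁, e₂, e, l₁, l₂⟩ := h.gate hr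
  obtain ⟨T', hT', r', t'', k', u₃, u₄, hm', hr', ht'', hst', e₃, e₄, e', l₃, l₄⟩ :=
    h'.symm.gate hr
  obtain rfl : T = T' := hT.eq_of_mem hT' (x := s.1) (y := t.1) (hs' ▸ mem_inc s')
    (ht' ▸ mem_inc t') (hsr ▸ hr' ▸ mem_inc r') (ht'' ▸ mem_inc t'') h.ne
  obtain rfl : t' = t'' := inc_injective (ht'.trans ht''.symm)
  have hr₂ := hr.left
  rw [e₂] at hr₂ hl
  obtain ⟨rfl, rfl⟩ := hRL.gu hT _ _ _ _ hm hm' (e₂.symm.trans e₄) hr₂ hl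
  have d₁ := desc_mul_gl.mpr l₁
  have d₃ := desc_mul_gl.mpr l₃
  rw [e', ← e] at d₃
  subst hs' hr'
  obtain rfl := eq_of_desc H hT d₁ d₃ (Subtype.ext hsr)
  left
  rw [e₁, e₃, mul_right_cancel (e.trans e'.symm)]
  exact ⟨rfl, rfl⟩

lemma cr_trans_ne_ne (H : ThreeFree m) (hRL : RL m n) (hr : Red (g₂ * lt m t)) (hl : ln g₂ ≤ n)
    (h : CrD g₁ s g₂ t) (h' : CrD g₂ t g₃ r) (hsr : s.1 ≠ r.1) (h2 : m s.1 t.1 ≠ 2) :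
    m r.1 t.1 = 2 := by
  by_contra h2'
  have hst := h.ne
  have htr := h'.ne
  have h2s : m t.1 s.1 ≠ 2 := H.symm s.1 t.1 ▸ h2
  have h2r : m t.1 r.1 ≠ 2 := H.symm r.1 t.1 ▸ h2'
  obtain ⟨p, hp⟩ := exists_strip t.1 hr.left
  have hrp := hp.red hr.left
  have hlp := hp.le.trans hl
  obtain ⟨q, hq⟩ := exists_strip s.1 hrp
  have hrq := hq.red hrp
  have hlq := hq.le.trans hlp
  obtain ⟨v, hv⟩ := exists_strip t.1 hrq
  obtain ⟨q', hq'⟩ := exists_strip r.1 hrp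
  obtain ⟨v', hv'⟩ := exists_strip t.1 (hq'.red hrp)
  obtain ⟨d₁, d₂, d₃⟩ := h.dn_strips H hRL h2 hr hl hp hq hv
  obtain ⟨d₄, d₅, d₆⟩ := h'.symm.dn_strips H hRL h2' hr hl hp hq' hv'
  by_cases hc : m s.1 r.1 = 2
  · have hz := Dn.strip_of_comm H hRL hsr.symm ((H.symm _ _).trans hc) hrp hlp d₄ hq
    exact not_dn_three H hRL htr hst.symm hsr.symm h2r h2s hrq hlq d₂ hz hv d₃
  · exact not_dn_three H hRL hsr hst htr.symm hc h2 hrp hlp d₁ d₄ hq d₂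

lemma cr_trans_two_ne (H : ThreeFree m) (hRL : RL m n) (hr : Red (g₂ * lt m t)) (hl : ln g₂ ≤ n)
    (h : CrD g₁ s g₂ t) (h' : CrD g₂ t g₃ r) (hsr : s.1 ≠ r.1) (h2 : m s.1 t.1 = 2)
    (h2' : m r.1 t.1 ≠ 2) : CrD g₁ s g₃ r := by
  have hst := h.ne
  have htr := h'.ne
  have h2r : m t.1 r.1 ≠ 2 := H.symm r.1 t.1 ▸ h2'
  obtain ⟨k, e₁, e₂⟩ := h.exists_of_comm H h2
  by_cases hc : m s.1 r.1 = 2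
  · obtain ⟨T, hT, t', r', k', u₂, u₃, rfl, rfl, htr', e₂', e₃, e, l₂, l₃⟩ := h'
    have hT' := hT.eq (mem_inc t') (mem_inc r') htr
    have hs : ∀ y : T, s.1 ≠ y ∧ m s.1 y = 2 := by
      intro y
      have hy := (Set.ext_iff.mp hT' y).mp y.2
      rcases hy with hy | hy <;> rw [hy]
      · exact ⟨hst, h2⟩
      · exact ⟨hsr, hc⟩
    have hr₂ := hr.left
    rw [e₂] at hr₂ hl
    rw [ln_mul, ln_lt] at hl
    obtain ⟨k'', rfl, rfl⟩ := hRL.exists_of_comm H hT hs u₂ (e₂.symm.trans e₂') hr₂ (by omega)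
    have h₁ : g₁ = k'' * emb u₃ * lt m (inc r') := by
      rw [e₁, mul_assoc, ← emb_mul_gl hT l₂, e, emb_mul_gl hT l₃, mul_assoc]
    have h₃ : g₃ = k'' * emb u₃ * lt m s := by
      rw [e₃, mul_assoc, lt_comm_emb H hT hs, mul_assoc]
    rw [h₁, h₃]
    exact CrD.of_comm H _ hsr hc
  · exfalso
    have hrs : m r.1 s.1 ≠ 2 := H.symm s.1 r.1 ▸ hc
    obtain ⟨p, hp⟩ := exists_strip t.1 hr.left
    have hrp := hp.red hr.left
    have hlp := hp.le.trans hl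
    obtain ⟨q, hq⟩ := exists_strip r.1 hrp
    obtain ⟨v, hv⟩ := exists_strip t.1 (hq.red hrp)
    obtain ⟨d₁, d₂, d₃⟩ := h'.symm.dn_strips H hRL h2' hr hl hp hq hv
    have hs : Dn s.1 p := Dn.strip_of_comm H hRL hst h2 hr.left hl (e₂ ▸ Dn.mul_lt _ _) hp
    exact not_dn_three H hRL hsr.symm htr.symm hst hrs h2' hrp hlp d₁ hs hq d₂

lemma cr_trans_two_two (H : ThreeFree m) (hRL : RL m n) (hr : Red (g₂ * lt m t)) (hl : ln g₂ ≤ n)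
    (h : CrD g₁ s g₂ t) (h' : CrD g₂ t g₃ r) (hsr : s.1 ≠ r.1) (h2 : m s.1 t.1 = 2)
    (h2' : m r.1 t.1 = 2) : CrD g₁ s g₃ r := by
  have hst := h.ne
  have htr := h'.ne
  obtain ⟨k, rfl, e₂⟩ := h.exists_of_comm H h2
  obtain ⟨k', rfl, e₂'⟩ := h'.symm.exists_of_comm H h2'
  have hr₂ := hr.left
  rw [e₂] at hr₂ hl
  rw [ln_mul, ln_lt] at hl
  obtain ⟨T, hT, s', r', j, u₁, u₂, rfl, rfl, hsr', rfl, rfl, e, l₁, l₂⟩ :=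
    hRL.crD (e₂.symm.trans e₂') hr₂ (by omega) hsr
  have hT' := hT.eq (mem_inc s') (mem_inc r') hsr
  have ht : ∀ y : T, t.1 ≠ y ∧ m t.1 y = 2 := by
    intro y
    have hy := (Set.ext_iff.mp hT' y).mp y.2
    rcases hy with hy | hy <;> rw [hy]
    · exact ⟨hst.symm, (H.symm _ _).trans h2⟩
    · exact ⟨htr, (H.symm _ _).trans h2'⟩
  refine ⟨T, hT, s', r', j * lt m t, u₁, u₂, rfl, rfl, hsr', ?_, ?_, e, l₁, l₂⟩ <;>
    rw [mul_assoc, mul_assoc, lt_comm_emb H hT ht]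

lemma cr_trans (H : ThreeFree m) (hRL : RL m n) : CrTrans m n := by
  intro g₁ g₂ g₃ s t r hr hl h h'
  rcases h with ⟨rfl, rfl⟩ | h
  · exact h'
  rcases h' with ⟨rfl, rfl⟩ | h'
  · exact .inr h
  by_cases hsr : s.1 = r.1
  · exact cr_trans_same H hRL hr hl.le h h' hsr
  right
  by_cases h2 : m s.1 t.1 = 2
  · by_cases h2' : m r.1 t.1 = 2
    · exact cr_trans_two_two H hRL hr hl.le h h' hsr h2 h2'
    · exact cr_trans_two_ne H hRL hr hl.le h h' hsr h2 h2'
  · have h2' := cr_trans_ne_ne H hRL hr hl.le h h' hsr h2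
    exact (cr_trans_two_ne H hRL hr hl.le h'.symm h.symm (Ne.symm hsr) h2' h2).symm

end Cases

lemma rl (H : ThreeFree m) (n : ℕ) : RL m n := by
  induction n with
  | zero => exact fun _ _ _ _ _ _ h => absurd h (Nat.not_lt_zero _)
  | succ n ih => exact ih.succ H (cr_trans H ih)

end Transitivity

section Reduced

variable {X : Type*} {m : X → X → ℕ∞}

lemma gate_desc (H : ThreeFree m) {T : Set X} (hT : IsPair T) {h g : Mon m}
    {u : ArtinGroup (sub m T)} {s : T × Bool} (hm : Tmin T h) (e : h * emb u = g * lt m (inc s))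
    (hr : Red (h * emb u)) : Desc u s ∧ g = h * emb (u * gl _ (flip s)) :=
  (rl H (ln g + 1)).gd hT h g u s hm e hr (Nat.lt_succ_self _)

/-- Multiplying a reduced element by a letter keeps it reduced unless there is an obvious
cancellation, for elements of length less than `n`. -/
def RedMul (m : X → X → ℕ∞) (n : ℕ) : Prop := ∀ (g : Mon m) (s : X × Bool), Red g → ln g < n →
  (∀ g', g ≠ g' * lt m (flip s)) → Red (g * lt m s)

lemma RedMul.gate (H : ThreeFree m) {n : ℕ} (hn : RedMul m n) {T : Set X} (hT : IsPair T)
    {h : Mon m} (hr : Red h) (hm : Tmin T h) (u : ArtinGroup (sub m T))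
    (hl : ln (h * emb u) ≤ n) : Red (h * emb u) := by
  induction hk : len u generalizing u with
  | zero => rwa [len_eq_zero.mp hk, emb_one hT, mul_one]
  | succ k ih =>
    have hu : u ≠ 1 := by
      rintro rfl
      simp at hk
    obtain ⟨t, v, e, hl'⟩ := exists_desc hu
    have hl₁ : ln (h * emb v) < n := by
      simp only [ln_mul, ln_emb] at hl ⊢
      omega
    have hv := ih v hl₁.le (by omega)
    rw [emb_split hT e hl', ← mul_assoc]
    refine hn _ _ hv hl₁ fun g' hg' => ?_
    rw [← inc_flip] at hg'
    refine not_desc_iff.mpr ?_ (gate_desc H hT hm hg' hv).1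
    rw [← e, hl']

/-- Removing the last letter leaves a reduced element not ending with the inverse letter. -/
def Good (m : X → X → ℕ∞) (w : Word X) : Prop := ∃ (v : Word X) (s : X × Bool), w = v ++ [s] ∧
  Red (cls m v) ∧ ∀ g', cls m v ≠ g' * lt m (flip s)

lemma Step.good (H : ThreeFree m) {n : ℕ} (hn : RedMul m n) {a b : Word X} (h : Step m a b)
    (hl : a.length = n + 1) (ha : Good m a) : Good m b := by
  obtain ⟨p, q, T, hT, x, y, hx, hy, hxy⟩ := h
  obtain ⟨w, s, hw, hr, hs⟩ := ha
  rcases List.eq_nil_or_concat q with rfl | ⟨q, r, rfl⟩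
  · rw [List.append_nil] at hw ⊢
    have hxy' : x.length = y.length := by rw [hx, hy, hxy]
    rcases List.eq_nil_or_concat x with rfl | ⟨x, s', rfl⟩
    · obtain rfl : y = [] := List.length_eq_zero_iff.mp (by rw [← hxy']; rfl)
      exact ⟨w, s, hw, hr, hs⟩
    · rcases List.eq_nil_or_concat y with rfl | ⟨y, t', rfl⟩
      · simp at hxy'
      · simp only [List.concat_eq_append, List.map_append, ← List.append_assoc, List.map_cons,
          List.map_nil] at hw ⊢
        obtain ⟨rfl, h1⟩ := List.append_inj' hw rfl
        obtain rfl : inc s' = s := by simpa using h1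
        refine ⟨_, _, rfl, ?_⟩
        simp only [List.concat_eq_append, ev_append, ev_singleton, List.length_append,
          List.length_map, List.length_cons] at hx hy hxy hxy' hl
        have lx := len_le (m := sub m T) x
        have ly := len_le (m := sub m T) y
        have lx' := len_mul_gl (ev (sub m T) x) s'
        have ly' := len_mul_gl (ev (sub m T) y) t'
        have ex : x.length = len (ev (sub m T) x) := by omega
        have ey : y.length = len (ev (sub m T) y) := by omega
        have c₁ : cls m (p ++ x.map inc) = cls m p * emb (ev (sub m T) x) := by
          rw [cls_append, emb_ev hT ex]
        have c₂ : cls m (p ++ y.map inc) = cls m p * emb (ev (sub m T) y) := by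
          rw [cls_append, emb_ev hT ey]
        rw [c₁] at hr hs
        rw [c₂]
        have hlp : ln (cls m p) = p.length := ln_cls p
        obtain ⟨h, v, hp, hm⟩ := exists_gate hT hr.left
        have hlh := congrArg ln hp
        rw [ln_mul, ln_emb] at hlh
        rw [hp] at hr hs ⊢
        have l₁ := len_mul_of_red hT hr
        rw [mul_assoc, ← emb_mul hT l₁] at hr hs
        have l₂ : len (v * ev (sub m T) x * gl _ s') = len (v * ev (sub m T) x) + 1 := by
          rw [← not_desc_iff]
          intro hd
          refine hs (h * emb (v * ev (sub m T) x * gl _ (flip (flip s')))) ?_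
          rw [mul_assoc h, ← inc_flip, ← emb_of_desc hT hd]
        have l₃ : len (v * ev (sub m T) y * gl _ t') = len v + len (ev (sub m T) y) + 1 := by
          rw [mul_assoc, ← hxy, ← mul_assoc, l₂, l₁]
          omega
        have l₄ := len_mul_le v (ev (sub m T) y)
        have l₅ := len_mul_gl (v * ev (sub m T) y) t'
        have l₆ : len (v * ev (sub m T) y) = len v + len (ev (sub m T) y) := by omega
        rw [mul_assoc, ← emb_mul hT l₆]
        have hR : Red (h * emb (v * ev (sub m T) y)) := by
          refine hn.gate H hT hr.left hm _ ?_
          rw [ln_mul, ln_emb]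
          omega
        refine ⟨hR, fun g' hg' => ?_⟩
        rw [← inc_flip] at hg'
        exact not_desc_iff.mpr (by omega) (gate_desc H hT hm hg' hR).1
  · simp only [List.concat_eq_append, ← List.append_assoc] at hw ⊢
    obtain ⟨rfl, h1⟩ := List.append_inj' hw rfl
    obtain rfl : r = s := by simpa using h1
    have e := cls_eq_iff.mpr (.rel _ _ (.mk p q T hT x y hx hy hxy))
    exact ⟨_, _, rfl, e ▸ hr, fun g' hg' => hs g' (e.trans hg')⟩

lemma Step.symm {a b : Word X} (h : Step m a b) : Step m b a := by
  obtain ⟨p, q, T, hT, x, y, hx, hy, hxy⟩ := h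
  exact ⟨p, q, T, hT, y, x, hy, hx, hxy.symm⟩

lemma good_iff (H : ThreeFree m) {n : ℕ} (hn : RedMul m n) {a b : Word X}
    (h : cls m a = cls m b) (hl : a.length = n + 1) : Good m a ↔ Good m b := by
  have h' := cls_eq_iff.mp h
  clear h
  induction h' with
  | rel a b h => exact ⟨h.good H hn hl, h.symm.good H hn (h.length_eq ▸ hl)⟩
  | refl a => rfl
  | symm a b hab ih =>
    have e := congrArg ln (cls_eq_iff.mpr hab)
    exact (ih (by simp only [ln_cls] at e; omega)).symm
  | trans a b c hab _ ih ih' =>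
    have e := congrArg ln (cls_eq_iff.mpr hab)
    exact (ih hl).trans (ih' (by simp only [ln_cls] at e; omega))

lemma Good.red {w : Word X} (h : ∀ v, cls m w = cls m v → Good m v) : Red (cls m w) := by
  intro a t b e
  obtain ⟨a, rfl⟩ := cls_surjective a
  obtain ⟨b, rfl⟩ := cls_surjective b
  obtain ⟨v, s, hv, hr, hs⟩ := h (a ++ [t] ++ [flip t] ++ b) e
  rcases List.eq_nil_or_concat b with rfl | ⟨b, r, rfl⟩
  · rw [List.append_nil] at hv
    obtain ⟨rfl, h1⟩ := List.append_inj' hv rfl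
    obtain rfl : flip t = s := by simpa using h1
    exact hs (cls m a) (by rw [flip_flip, cls_concat])
  · rw [List.concat_eq_append, ← List.append_assoc] at hv
    obtain ⟨rfl, h1⟩ := List.append_inj' hv rfl
    exact hr (cls m a) t (cls m b) rfl

lemma redMul (H : ThreeFree m) (n : ℕ) : RedMul m n := by
  induction n with
  | zero => exact fun _ _ _ h => absurd h (Nat.not_lt_zero _)
  | succ n ih =>
    intro g s hr hl hs
    rcases Nat.lt_succ_iff_lt_or_eq.mp hl with hl | hl
    · exact ih g s hr hl hs
    · obtain ⟨w, rfl⟩ := cls_surjective g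
      rw [← cls_concat]
      refine Good.red fun v hv => ?_
      refine (good_iff H ih hv ?_).mp ⟨w, s, rfl, hr, hs⟩
      rw [List.length_append, List.length_singleton, ← ln_cls (m := m), hl]

lemma Red.mul_lt (H : ThreeFree m) {g : Mon m} {s : X × Bool} (hr : Red g)
    (hs : ∀ g', g ≠ g' * lt m (flip s)) : Red (g * lt m s) :=
  redMul H _ g s hr (Nat.lt_succ_self _) hs

lemma Red.mul_emb (H : ThreeFree m) {T : Set X} (hT : IsPair T) {h : Mon m} (hr : Red h)
    (hm : Tmin T h) (u : ArtinGroup (sub m T)) : Red (h * emb u) :=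
  (redMul H _).gate H hT hr hm u le_rfl

lemma red_one : Red (1 : Mon m) := by
  intro a s b h
  have := congrArg ln h
  simp only [ln_mul, ln_one, ln_lt] at this
  omega

open Classical in
/-- Right multiplication of a reduced element by a letter. -/
noncomputable def act (s : X × Bool) (g : Mon m) : Mon m :=
  if h : ∃ g', g = g' * lt m (flip s) then h.choose else g * lt m s

lemma act_gate (H : ThreeFree m) {T : Set X} (hT : IsPair T) {h : Mon m} (hr : Red h)
    (hm : Tmin T h) (u : ArtinGroup (sub m T)) (s : T × Bool) :
    act (inc s) (h * emb u) = h * emb (u * gl _ s) := by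
  have hru := hr.mul_emb H hT hm u
  unfold act
  split_ifs with hex
  · have e := hex.choose_spec
    have := (gate_desc H hT (s := flip s) hm e hru).2
    rwa [flip_flip] at this
  · have hd : ¬ Desc u (flip s) := by
      intro hd
      exact hex ⟨h * emb (u * gl _ (flip (flip s))), by
        rw [mul_assoc, ← inc_flip, ← emb_of_desc hT hd]⟩
    rw [emb_mul_gl hT (not_desc_iff.mp hd), mul_assoc]

lemma act_of_red {g : Mon m} {s : X × Bool} (hr : Red (g * lt m s)) :
    act s g = g * lt m s := by
  unfold act
  rw [dif_neg]
  rintro ⟨g', rfl⟩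
  exact not_red_flip g' s 1 (by rwa [mul_one])

lemma exists_gate_letter [Nontrivial X] (s : X × Bool) {g : Mon m} (hr : Red g) :
    ∃ (T : Set X) (_ : IsPair T) (h : Mon m) (u : ArtinGroup (sub m T)) (s' : T × Bool),
      g = h * emb u ∧ Tmin T h ∧ Red h ∧ inc s' = s := by
  obtain ⟨y, hy⟩ := exists_ne s.1
  obtain ⟨T, hT, hs, -⟩ := exists_isPair hy.symm
  obtain ⟨s', hs'⟩ := exists_inc hs
  obtain ⟨h, u, rfl, hm⟩ := exists_gate hT hr
  exact ⟨T, hT, h, u, s', rfl, hm, hr.left, hs'⟩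

lemma act_red (H : ThreeFree m) [Nontrivial X] (s : X × Bool) {g : Mon m} (hr : Red g) :
    Red (act s g) := by
  obtain ⟨T, hT, h, u, s, rfl, hm, hrh, rfl⟩ := exists_gate_letter s hr
  rw [act_gate H hT hrh hm]
  exact hrh.mul_emb H hT hm _

lemma act_flip_act (H : ThreeFree m) [Nontrivial X] (s : X × Bool) {g : Mon m} (hr : Red g) :
    act (flip s) (act s g) = g := by
  obtain ⟨T, hT, h, u, s, rfl, hm, hrh, rfl⟩ := exists_gate_letter s hr
  rw [act_gate H hT hrh hm, ← inc_flip, act_gate H hT hrh hm, gl_flip, mul_inv_cancel_right]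

/-- Right multiplication by an inverse letter as a permutation of the reduced elements. -/
noncomputable def actPerm (H : ThreeFree m) [Nontrivial X] (s : X × Bool) :
    Equiv.Perm {g : Mon m // Red g} where
  toFun g := ⟨act (flip s) g, act_red H _ g.2⟩
  invFun g := ⟨act s g, act_red H _ g.2⟩
  left_inv g := Subtype.ext (by
    have := act_flip_act H (flip s) g.2
    rwa [flip_flip] at this)
  right_inv g := Subtype.ext (act_flip_act H s g.2)

lemma actPerm_flip (H : ThreeFree m) [Nontrivial X] (s : X × Bool) :
    actPerm H (flip s) = (actPerm H s)⁻¹ := by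
  ext g
  change act (flip (flip s)) g.1 = act s g.1
  rw [flip_flip]

lemma lift_actPerm (H : ThreeFree m) [Nontrivial X] {T : Set X} (hT : IsPair T) {h : Mon m}
    (hr : Red h) (hm : Tmin T h) (F : FreeGroup T) : ∀ (u : ArtinGroup (sub m T)),
    (FreeGroup.lift (fun x => actPerm H (x, true)) (FreeGroup.map Subtype.val F))
      ⟨h * emb u, hr.mul_emb H hT hm u⟩ =
      ⟨h * emb (u * (PresentedGroup.mk (artinRels (sub m T)) F)⁻¹), hr.mul_emb H hT hm _⟩ := by
  induction F using FreeGroup.induction_on with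
  | C1 => simp
  | of x =>
    intro u
    rw [FreeGroup.map.of, FreeGroup.lift_apply_of]
    exact Subtype.ext (act_gate H hT hr hm u (x, false))
  | inv_of x _ =>
    intro u
    rw [map_inv, map_inv, FreeGroup.map.of, FreeGroup.lift_apply_of, map_inv, inv_inv]
    exact Subtype.ext (act_gate H hT hr hm u (x, true))
  | mul F F' ih ih' =>
    intro u
    rw [map_mul, map_mul, Equiv.Perm.mul_apply, ih', ih]
    simp only [map_mul, mul_inv_rev, mul_assoc]

lemma map_altProd {T : Set X} (n : ℕ) (x y : T) :
    FreeGroup.map Subtype.val (altProd n x y) = altProd n (x : X) (y : X) := by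
  induction n generalizing x y with
  | zero => rfl
  | succ n ih => rw [altProd, map_mul, ih, FreeGroup.map.of, altProd]

/-- The action of the Artin group on reduced elements. -/
noncomputable def actHom (H : ThreeFree m) [Nontrivial X] :
    ArtinGroup m →* Equiv.Perm {g : Mon m // Red g} :=
  PresentedGroup.toGroup (f := fun x => actPerm H (x, true)) (by
    rintro r ⟨x, y, k, hxy, hk, rfl⟩
    rw [map_mul, map_inv, mul_inv_eq_one]
    obtain ⟨T, hT, hx, hy⟩ := exists_isPair hxy
    ext ⟨g, hg⟩
    obtain ⟨h, u, rfl, hm⟩ := exists_gate hT hg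
    have e : PresentedGroup.mk (artinRels (sub m T)) (altProd k ⟨x, hx⟩ ⟨y, hy⟩) =
        PresentedGroup.mk (artinRels (sub m T)) (altProd k ⟨y, hy⟩ ⟨x, hx⟩) := by
      rw [← mul_inv_eq_one, ← map_inv, ← map_mul]
      exact PresentedGroup.one_of_mem
        ⟨⟨x, hx⟩, ⟨y, hy⟩, k, fun h => hxy (congrArg Subtype.val h), hk, rfl⟩
    have e₁ := lift_actPerm H hT hg.left hm (altProd k ⟨x, hx⟩ ⟨y, hy⟩) u
    have e₂ := lift_actPerm H hT hg.left hm (altProd k ⟨y, hy⟩ ⟨x, hx⟩) u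
    rw [map_altProd] at e₁ e₂
    rw [e₁, e₂]
    simp only [e])

lemma actHom_gl (H : ThreeFree m) [Nontrivial X] (s : X × Bool) :
    actHom H (gl m s) = actPerm H s := by
  have h : ∀ x : X, actHom H (artinGen m x) = actPerm H (x, true) :=
    fun x => PresentedGroup.toGroup.of _
  rcases s with ⟨x, _ | _⟩
  · have h1 : gl m (x, false) = (artinGen m x)⁻¹ := rfl
    rw [h1, map_inv, h, ← actPerm_flip]
    rfl
  · exact h x

lemma actHom_ev_inv (H : ThreeFree m) [Nontrivial X] {w : Word X} (hr : Red (cls m w)) :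
    actHom H (ev m w)⁻¹ ⟨1, red_one⟩ = ⟨cls m w, hr⟩ := by
  induction w using List.reverseRecOn with
  | nil => simp
  | append_singleton w s ih =>
    rw [cls_concat] at hr
    rw [ev_append, ev_singleton, mul_inv_rev, map_mul, Equiv.Perm.mul_apply, ih hr.left,
      ← gl_flip, actHom_gl]
    refine Subtype.ext ?_
    change act (flip (flip s)) (cls m w) = cls m w * lt m s
    rw [flip_flip, act_of_red hr]

/-- The homomorphism induced by the inclusion of generators. -/
def subHom (m : X → X → ℕ∞) (T : Set X) : ArtinGroup (sub m T) →* ArtinGroup m :=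
  PresentedGroup.toGroup (f := fun x : T => artinGen m (x : X)) (by
    rintro r ⟨x, y, k, hxy, hk, rfl⟩
    have e : ∀ F : FreeGroup T, FreeGroup.lift (fun x : T => artinGen m (x : X)) F =
        PresentedGroup.mk (artinRels m) (FreeGroup.map Subtype.val F) := by
      intro F
      rw [← MonoidHom.comp_apply]
      congr 1
      ext x
      simp [artinGen, PresentedGroup.of]
    rw [e, map_mul, map_inv, map_altProd, map_altProd]
    exact PresentedGroup.one_of_mem ⟨x, y, k, fun h => hxy (Subtype.ext h), hk, rfl⟩)

lemma subHom_ev {T : Set X} (w : Word T) : subHom m T (ev (sub m T) w) = ev m (w.map inc) := by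
  have h : ∀ x : T, subHom m T (artinGen _ x) = artinGen m (x : X) :=
    fun x => PresentedGroup.toGroup.of _
  induction w with
  | nil => simp
  | cons s w ih =>
    rw [ev_cons, map_mul, ih, List.map_cons, ev_cons]
    congr 1
    rcases s with ⟨x, _ | _⟩
    · exact (map_inv (subHom m T) (artinGen _ x)).trans (congrArg _ (h x))
    · exact h x

lemma ev_eq_of_cls_eq {u v : Word X} (h : cls m u = cls m v) : ev m u = ev m v := by
  have h' := cls_eq_iff.mp h
  clear h
  induction h' with
  | rel a b h =>
    obtain ⟨p, q, T, hT, x, y, hx, hy, hxy⟩ := h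
    simp only [ev_append, ← subHom_ev, hxy]
  | refl a => rfl
  | symm a b _ ih => exact ih.symm
  | trans a b c _ _ ih ih' => exact ih.trans ih'

lemma red_of_isGeodesic {w : Word X} (hw : IsGeodesic (artinGen m) w) : Red (cls m w) := by
  intro a s b e
  obtain ⟨a, rfl⟩ := cls_surjective a
  obtain ⟨b, rfl⟩ := cls_surjective b
  have e₁ : cls m w = cls m (a ++ [s] ++ [flip s] ++ b) := e
  have e₂ := ev_eq_of_cls_eq e₁
  have hl := congrArg ln e₁
  have e₃ : ev m (a ++ b) = ev m w := by
    rw [e₂]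
    simp
  have h := hw (a ++ b) e₃
  simp only [ln_cls, List.length_append, List.length_singleton] at hl h
  omega

/-- Equivalent geodesic words are related by dihedral replacements. -/
lemma cls_eq_of_isGeodesic (H : ThreeFree m) [Nontrivial X] {u v : Word X}
    (hu : IsGeodesic (artinGen m) u) (hv : IsGeodesic (artinGen m) v) (h : ev m u = ev m v) :
    cls m u = cls m v := by
  have h₁ := actHom_ev_inv H (red_of_isGeodesic hu)
  have h₂ := actHom_ev_inv H (red_of_isGeodesic hv)
  rw [h, h₂] at h₁
  exact (congrArg Subtype.val h₁).symm

lemma last_letter (H : ThreeFree m) {a b z : X} (hab : a ≠ b) (hza : z ≠ a) (hzb : z ≠ b)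
    (h2 : m a b ≠ 2) (h2' : m a z ≠ 2) {g g' : Mon m} {δ ε η : Bool}
    (e : g * lt m (b, δ) * lt m (a, ε) = g' * lt m (z, η))
    (hr : Red (g * lt m (b, δ) * lt m (a, ε))) : False := by
  have hRL := rl H (ln (g * lt m (b, δ) * lt m (a, ε)))
  have hl : ln (g * lt m (b, δ)) ≤ ln (g * lt m (b, δ) * lt m (a, ε)) := by simp
  obtain ⟨p, hp⟩ := exists_strip a hr.left
  obtain ⟨q, hq⟩ := exists_strip b (hp.red hr.left)
  obtain ⟨r, hr'⟩ := exists_strip a (hq.red (hp.red hr.left))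
  refine not_dn_three H hRL hza.symm hab hzb h2' h2 hr le_rfl (Dn.mul_lt _ (a, ε))
    (e ▸ Dn.mul_lt _ (z, η)) (hp.mul_lt rfl hr) ?_
  have hb : Dn b (g * lt m (b, δ)) := Dn.mul_lt _ (b, δ)
  by_cases ha : Dn a (g * lt m (b, δ))
  · exact (Dn.strips H hRL hab.symm (H.symm a b ▸ h2) hr.left hl hb ha hp hq hr').1
  · have hs : IsStrip a (g * lt m (b, δ)) (g * lt m (b, δ)) := ⟨⟨(a, true), 0, rfl, by simp⟩, ha⟩
    rw [hp.unique hRL hr.left hl hs]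
    exact hb

end Reduced

end ArtinGeodesic

/-- In a 3-free Artin group, if `a, b, c` are pairwise distinct generators with
`m a b > 3` and `m b c > 3`, and `w b^δ a^ε` is a geodesic word, then every geodesic word
representing the same element ends in a letter `a^±`, `b^±`, or `z^±` for some generator `z`
with `m a z = 2` (a letter commuting with `a`). -/
theorem threeFree_equivalent_geodesic_last_letter_ba {X : Type*} [Fintype X] (m : X → X → ℕ∞)
    (hsymm : ∀ x y : X, m x y = m y x) (hge2 : ∀ x y : X, x ≠ y → 2 ≤ m x y)
    (h3free : ∀ x y : X, x ≠ y → m x y ≠ 3)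
    (a b c : X) (hab : a ≠ b) (hbc : b ≠ c) (hac : a ≠ c)
    (hmab : 3 < m a b) (hmbc : 3 < m b c)
    (δ ε : Bool) (w : Word X)
    (hgeo : IsGeodesic (artinGen m) (w ++ [(b, δ), (a, ε)])) :
    ∀ v : Word X, IsGeodesic (artinGen m) v →
      evalWord (artinGen m) v = evalWord (artinGen m) (w ++ [(b, δ), (a, ε)]) →
      ∃ (z : X) (η : Bool), v.getLast? = some (z, η) ∧ (z = a ∨ z = b ∨ m a z = 2) := by
  intro v hv e
  have H : ArtinGeodesic.ThreeFree m := ⟨hsymm, hge2, h3free⟩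
  have : Nontrivial X := ⟨a, b, hab⟩
  have hc := ArtinGeodesic.cls_eq_of_isGeodesic H hgeo hv e.symm
  rcases List.eq_nil_or_concat v with rfl | ⟨v, ⟨z, η⟩, rfl⟩
  · simpa using congrArg ArtinGeodesic.ln hc
  · refine ⟨z, η, by simp, ?_⟩
    by_contra! hz
    have h2 : m a b ≠ 2 := fun h => by
      rw [h] at hmab
      exact absurd hmab (by decide)
    rw [List.concat_eq_append] at hc
    have hr := ArtinGeodesic.red_of_isGeodesic hgeo
    rw [show w ++ [(b, δ), (a, ε)] = w ++ [(b, δ)] ++ [(a, ε)] by simp] at hc hr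
    exact ArtinGeodesic.last_letter (g := ArtinGeodesic.cls m w) (g' := ArtinGeodesic.cls m v) H hab hz.1 hz.2.1 h2 hz.2.2 hc hr
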